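/- arXiv:1608.08000 — 10 statements merged into one kernel-verified Lean document; each statement's English description precedes it below -/
import Mathlib

section
/- The feasible set of problem Π is nonempty if and only if Σ_{e=1}^l α(e) ≤ Σ_{e=1}^l β(e) for every l = 1,…,n. -/
/-- Feasibility for problem Π (data indexed `1,…,n`): `0 ≤ x e ≤ β e` for each `e`,
ascending constraints `∑_{e=1}^l x e ≥ ∑_{e=1}^l α e` for `l = 1,…,n-1`, and equality at `n`. -/
def PiFeasible (n : ℕ) (α β : ℕ → ℝ) (x : ℕ → ℝ) : Prop :=
  (∀ e, 1 ≤ e → e ≤ n → 0 ≤ x e ∧ x e ≤ β e) ∧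
  (∀ l, 1 ≤ l → l ≤ n - 1 →
    ∑ e ∈ Finset.Icc 1 l, α e ≤ ∑ e ∈ Finset.Icc 1 l, x e) ∧
  ∑ e ∈ Finset.Icc 1 n, x e = ∑ e ∈ Finset.Icc 1 n, α e

/-- The feasible set of problem Π is nonempty if and only if
`∑_{e=1}^l α e ≤ ∑_{e=1}^l β e` for every `l = 1,…,n`. -/
theorem feasibleSet_nonempty_iff (n : ℕ) (hn : 1 ≤ n) (α β : ℕ → ℝ)
    (hα : ∀ e, 0 ≤ α e) (hβ : ∀ e, 0 < β e) :
    (∃ x : ℕ → ℝ, PiFeasible n α β x) ↔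
      ∀ l, 1 ≤ l → l ≤ n →
        ∑ e ∈ Finset.Icc 1 l, α e ≤ ∑ e ∈ Finset.Icc 1 l, β e := by
  constructor
  · rintro ⟨x, h1, h2, h3⟩ l hl hln
    have hx : ∑ e ∈ Finset.Icc 1 l, x e ≤ ∑ e ∈ Finset.Icc 1 l, β e := by
      apply Finset.sum_le_sum
      intro e he
      rw [Finset.mem_Icc] at he
      exact (h1 e he.1 (he.2.trans hln)).2
    rcases Nat.lt_or_ge l n with h | h
    · exact (h2 l hl (by omega)).trans hx
    · obtain rfl : l = n := le_antisymm hln h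
      rw [← h3]
      exact hx
  · intro h
    have hmono : ∀ l, l ≤ n → ∑ e ∈ Finset.Icc 1 l, α e ≤ ∑ e ∈ Finset.Icc 1 n, α e := by
      intro l hl
      exact Finset.sum_le_sum_of_subset_of_nonneg (Finset.Icc_subset_Icc_right hl)
        (fun i _ _ => hα i)
    have hA : 0 ≤ ∑ e ∈ Finset.Icc 1 n, α e := Finset.sum_nonneg (fun i _ => hα i)
    generalize hAn : ∑ e ∈ Finset.Icc 1 n, α e = A at hmono hA
    let X : ℕ → ℝ := fun l => min (∑ e ∈ Finset.Icc 1 l, β e) A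
    have hsum : ∀ l, ∑ e ∈ Finset.Icc 1 l, (X e - X (e - 1)) = X l := by
      intro l
      induction l with
      | zero => simp [X, hA]
      | succ k ih =>
        rw [Finset.sum_Icc_succ_top (by omega), ih]
        simp
    have hX : ∀ l, 1 ≤ l → l ≤ n → ∑ e ∈ Finset.Icc 1 l, α e ≤ X l := fun l h1 h2 =>
      le_min (h l h1 h2) (hmono l h2)
    refine ⟨fun e => X e - X (e - 1), ?_, ?_, ?_⟩
    · intro e he _
      obtain ⟨k, rfl⟩ : ∃ k, e = k + 1 := ⟨e - 1, by omega⟩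
      have hb := hβ (k + 1)
      simp only [X, Nat.add_sub_cancel]
      rw [Finset.sum_Icc_succ_top (by omega)]
      constructor
      · have := min_le_min_right A
          (show ∑ e ∈ Finset.Icc 1 k, β e ≤ ∑ e ∈ Finset.Icc 1 k, β e + β (k + 1) by linarith)
        linarith
      · rcases min_cases (∑ e ∈ Finset.Icc 1 k, β e) A with h1 | h1 <;>
          rcases min_cases (∑ e ∈ Finset.Icc 1 k, β e + β (k + 1)) A with h2 | h2 <;>
          linarith [h1.1, h1.2, h2.1, h2.2]
    · intro l hl hln
      rw [hsum]
      exact hX l hl (by omega)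
    · rw [hsum, hAn]
      exact le_antisymm (min_le_right _ _) (hAn ▸ hX n hn le_rfl)
end

section
/- The set function f defined by f(A) = c(n) − ζ(E∖A) is a rank function: it is nonnegative, satisfies f(∅) = 0, is nondecreasing, and is submodular; hence (E, f) is a polymatroid. -/
attribute [local instance] Classical.propDecidable

/-- A rank function on the finite ground set `E`: nonnegative, zero on `∅`,
nondecreasing and submodular.  `(E, f)` is then a polymatroid. -/
def IsRankFunction {E : Type*} [Fintype E] [DecidableEq E] (f : Finset E → ℝ) : Prop :=
  f ∅ = 0 ∧ (∀ A, 0 ≤ f A) ∧ (∀ A B : Finset E, A ⊆ B → f A ≤ f B) ∧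
    ∀ A B : Finset E, f (A ∪ B) + f (A ∩ B) ≤ f A + f B

/-- `c j = ∑_{e=1}^j α(e)` where the ground set `{1,…,n}` is modelled by `Fin n`
(element `e : Fin n` stands for the index `e+1`, i.e. `{1,…,j}` is `{e | (e : ℕ) < j}`). -/
noncomputable def cSum (n : ℕ) (α : Fin n → ℝ) (j : ℕ) : ℝ :=
  ∑ e ∈ Finset.univ.filter (fun e : Fin n => (e : ℕ) < j), α e

/-- `ζ(A) = max{c j : {1,…,j} ⊆ A, 0 ≤ j ≤ n}`. -/
noncomputable def zeta (n : ℕ) (α : Fin n → ℝ) (A : Finset (Fin n)) : ℝ :=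
  ((Finset.range (n + 1)).filter (fun j => ∀ e : Fin n, (e : ℕ) < j → e ∈ A)).sup'
    ⟨0, by simp⟩ (cSum n α)

/-- `f(A) = c(n) - ζ(E \ A)`. -/
noncomputable def rankF (n : ℕ) (α : Fin n → ℝ) (A : Finset (Fin n)) : ℝ :=
  cSum n α n - zeta n α (Finset.univ \ A)

theorem cSum_mono_aux (n : ℕ) (α : Fin n → ℝ) (hα : ∀ e, 0 ≤ α e) {i j : ℕ} (h : i ≤ j) :
    cSum n α i ≤ cSum n α j := by
  unfold cSum
  apply Finset.sum_le_sum_of_subset_of_nonneg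
  · intro e he
    simp only [Finset.mem_filter, Finset.mem_univ, true_and] at he ⊢
    omega
  · intro e _ _
    exact hα e

theorem le_zeta_aux (n : ℕ) (α : Fin n → ℝ) (A : Finset (Fin n)) (j : ℕ) (hj : j ≤ n)
    (h : ∀ e : Fin n, (e : ℕ) < j → e ∈ A) : cSum n α j ≤ zeta n α A := by
  unfold zeta
  apply Finset.le_sup' (cSum n α)
  simp only [Finset.mem_filter, Finset.mem_range]
  exact ⟨by omega, h⟩

theorem zeta_eq_aux (n : ℕ) (α : Fin n → ℝ) (A : Finset (Fin n)) :
    ∃ j, j ≤ n ∧ (∀ e : Fin n, (e : ℕ) < j → e ∈ A) ∧ zeta n α A = cSum n α j := by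
  unfold zeta
  obtain ⟨j, hj, he⟩ := Finset.exists_mem_eq_sup'
    (s := (Finset.range (n + 1)).filter (fun j => ∀ e : Fin n, (e : ℕ) < j → e ∈ A))
    ⟨0, by simp⟩ (cSum n α)
  simp only [Finset.mem_filter, Finset.mem_range] at hj
  exact ⟨j, by omega, hj.2, he⟩

/-- The set function `f(A) = c(n) − ζ(E∖A)` is a rank function, i.e. `(E, f)` is a
polymatroid. -/
theorem rankF_isRankFunction (n : ℕ) (hn : 1 ≤ n) (α : Fin n → ℝ) (hα : ∀ e, 0 ≤ α e) :
    IsRankFunction (rankF n α) := by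
  refine ⟨?_, ?_, ?_, ?_⟩
  · obtain ⟨j, hj, _, he⟩ := zeta_eq_aux n α (Finset.univ \ ∅)
    have h1 := le_zeta_aux n α (Finset.univ \ ∅) n le_rfl (by simp)
    have h2 := cSum_mono_aux n α hα hj
    unfold rankF
    linarith
  · intro A
    obtain ⟨j, hj, _, he⟩ := zeta_eq_aux n α (Finset.univ \ A)
    have h2 := cSum_mono_aux n α hα hj
    unfold rankF
    linarith
  · intro A B hAB
    obtain ⟨j, hj, hm, he⟩ := zeta_eq_aux n α (Finset.univ \ B)
    have h1 := le_zeta_aux n α (Finset.univ \ A) j hj (by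
      intro e h
      have := hm e h
      simp only [Finset.mem_sdiff, Finset.mem_univ, true_and] at this ⊢
      exact fun h' => this (hAB h'))
    unfold rankF
    linarith
  · intro A B
    obtain ⟨i, hi, hmi, hei⟩ := zeta_eq_aux n α (Finset.univ \ A)
    obtain ⟨j, hj, hmj, hej⟩ := zeta_eq_aux n α (Finset.univ \ B)
    simp only [Finset.mem_sdiff, Finset.mem_univ, true_and] at hmi hmj
    have hU := le_zeta_aux n α (Finset.univ \ (A ∪ B)) (min i j) (by omega) (by
      intro e h
      have h1 := hmi e (by omega)
      have h2 := hmj e (by omega)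
      simp [h1, h2])
    have hI := le_zeta_aux n α (Finset.univ \ (A ∩ B)) (max i j) (by omega) (by
      intro e h
      simp only [Finset.mem_sdiff, Finset.mem_univ, true_and, Finset.mem_inter]
      rintro ⟨ha, hb⟩
      rcases lt_max_iff.1 h with h | h
      · exact hmi e h ha
      · exact hmj e h hb)
    have hs : cSum n α (min i j) + cSum n α (max i j) = cSum n α i + cSum n α j := by
      rcases le_total i j with h | h
      · simp [h]
      · simp [h, add_comm]
    unfold rankF
    linarith
end

section
/- The set of x ∈ ℝ_{≥0}^n satisfying the linear ascending constraints Σ_{e=1}^l x(e) ≥ Σ_{e=1}^l α(e) for l = 1,…,n−1 and Σ_{e=1}^n x(e) = Σ_{e=1}^n α(e) equals the base B(f) of the polymatroid (E, f). -/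
attribute [local instance] Classical.propDecidable

/-- The polymatroidal polyhedron `P(f)` of independent vectors. -/
def polyP {E : Type*} [Fintype E] (f : Finset E → ℝ) : Set (E → ℝ) :=
  {x | (∀ e, 0 ≤ x e) ∧ ∀ A : Finset E, ∑ e ∈ A, x e ≤ f A}

/-- The base `B(f)` of the polymatroid `(E, f)`. -/
def polyBase {E : Type*} [Fintype E] (f : Finset E → ℝ) : Set (E → ℝ) :=
  {x ∈ polyP f | ∑ e, x e = f Finset.univ}

/-- The set of nonnegative vectors satisfying the linear ascending constraints
equals the base `B(f)` of the polymatroid `(E, f)`. -/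
theorem ascendingConstraints_eq_base (n : ℕ) (hn : 1 ≤ n) (α : Fin n → ℝ)
    (hα : ∀ e, 0 ≤ α e) :
    {x : Fin n → ℝ |
        (∀ e, 0 ≤ x e) ∧
        (∀ l, 1 ≤ l → l ≤ n - 1 →
          cSum n α l ≤ ∑ e ∈ Finset.univ.filter (fun e : Fin n => (e : ℕ) < l), x e) ∧
        ∑ e, x e = cSum n α n} = polyBase (rankF n α) := by
  have hz : rankF n α Finset.univ = cSum n α n := by
    have h0 : zeta n α (Finset.univ \ Finset.univ) = 0 := by
      unfold zeta
      apply le_antisymm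
      · apply Finset.sup'_le
        intro j hj
        rw [Finset.mem_filter] at hj
        have hj0 : j = 0 := by
          by_contra h
          have := hj.2 ⟨0, hn⟩ (Nat.pos_of_ne_zero h)
          simp at this
        subst hj0
        simp [cSum]
      · have h : (0 : ℝ) = cSum n α 0 := by simp [cSum]
        rw [h]
        apply Finset.le_sup'
        simp
    unfold rankF
    rw [h0, sub_zero]
  ext x
  simp only [polyBase, polyP, Set.mem_setOf_eq, hz]
  constructor
  · rintro ⟨hx, hl, hs⟩
    refine ⟨⟨hx, fun A => ?_⟩, hs⟩
    have hall : ∀ l, l ≤ n →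
        cSum n α l ≤ ∑ e ∈ Finset.univ.filter (fun e : Fin n => (e : ℕ) < l), x e := by
      intro l hln
      rcases Nat.eq_zero_or_pos l with h | h
      · subst h
        simp [cSum]
      · by_cases h' : l ≤ n - 1
        · exact hl l h h'
        · have : l = n := by omega
          subst this
          rw [← hs]
          simp
    have hzA : zeta n α (Finset.univ \ A) ≤ ∑ e ∈ Finset.univ \ A, x e := by
      unfold zeta
      apply Finset.sup'_le
      intro j hj
      rw [Finset.mem_filter, Finset.mem_range] at hj
      refine (hall j (by omega)).trans ?_
      apply Finset.sum_le_sum_of_subset_of_nonneg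
      · intro e he
        exact hj.2 e (Finset.mem_filter.1 he).2
      · intro e _ _
        exact hx e
    have hsum := Finset.sum_sdiff (f := x) (Finset.subset_univ A)
    unfold rankF
    linarith
  · rintro ⟨⟨hx, hA⟩, hs⟩
    refine ⟨hx, fun l _ hl => ?_, hs⟩
    set B := Finset.univ.filter (fun e : Fin n => (e : ℕ) < l) with hB
    have h1 := hA (Finset.univ \ B)
    have h2 : cSum n α l ≤ zeta n α (Finset.univ \ (Finset.univ \ B)) := by
      unfold zeta
      apply Finset.le_sup'
      rw [Finset.mem_filter, Finset.mem_range]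
      refine ⟨by omega, fun e he => ?_⟩
      simp [hB, he]
    have hsum := Finset.sum_sdiff (f := x) (Finset.subset_univ B)
    unfold rankF at h1
    linarith
end

section
/- If f is a rank function on E and β ∈ ℝ_{≥0}^E, then the set function f_β defined by f_β(A) = min_{D ⊆ A} (f(D) + β(A∖D)) is a rank function, i.e., (E, f_β) is a polymatroid. -/
/-- `f_β(A) = min_{D ⊆ A} (f(D) + β(A ∖ D))`. -/
noncomputable def fbeta {E : Type*} [DecidableEq E] (f : Finset E → ℝ) (β : E → ℝ)
    (A : Finset E) : ℝ :=
  A.powerset.inf' ⟨∅, Finset.empty_mem_powerset A⟩ (fun D => f D + ∑ e ∈ A \ D, β e)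

theorem fbeta_le_aux {E : Type*} [DecidableEq E] (f : Finset E → ℝ) (β : E → ℝ)
    {A D : Finset E} (h : D ⊆ A) : fbeta f β A ≤ f D + ∑ e ∈ A \ D, β e :=
  Finset.inf'_le (fun D => f D + ∑ e ∈ A \ D, β e) (Finset.mem_powerset.2 h)

theorem fbeta_exists_aux {E : Type*} [DecidableEq E] (f : Finset E → ℝ) (β : E → ℝ)
    (A : Finset E) : ∃ D ⊆ A, fbeta f β A = f D + ∑ e ∈ A \ D, β e := by
  obtain ⟨D, hD, h⟩ := Finset.exists_mem_eq_inf' ⟨∅, Finset.empty_mem_powerset A⟩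
    (fun D => f D + ∑ e ∈ A \ D, β e)
  exact ⟨D, Finset.mem_powerset.1 hD, h⟩

/-- If `f` is a rank function on `E` and `β ∈ ℝ_{≥0}^E`, then `f_β` is a rank
function, i.e. `(E, f_β)` is a polymatroid. -/
theorem fbeta_isRankFunction {E : Type*} [Fintype E] [DecidableEq E]
    (f : Finset E → ℝ) (hf : IsRankFunction f) (β : E → ℝ) (hβ : ∀ e, 0 ≤ β e) :
    IsRankFunction (fbeta f β) := by
  obtain ⟨h0, hn, hm, hs⟩ := hf
  have hnn : ∀ A, 0 ≤ fbeta f β A := by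
    intro A
    obtain ⟨D, hD, h⟩ := fbeta_exists_aux f β A
    rw [h]
    exact add_nonneg (hn D) (Finset.sum_nonneg fun e _ => hβ e)
  refine ⟨le_antisymm ?_ (hnn ∅), hnn, ?_, ?_⟩
  · have := fbeta_le_aux f β (Finset.Subset.refl (∅ : Finset E))
    simpa [h0] using this
  · intro A B hAB
    obtain ⟨D, hD, h⟩ := fbeta_exists_aux f β B
    rw [h]
    refine (fbeta_le_aux f β (Finset.inter_subset_left : A ∩ D ⊆ A)).trans ?_
    refine add_le_add (hm _ _ Finset.inter_subset_right) ?_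
    refine Finset.sum_le_sum_of_subset_of_nonneg ?_ fun e _ _ => hβ e
    intro e he
    have := @hAB e
    simp only [Finset.mem_sdiff, Finset.mem_inter] at he ⊢
    tauto
  · intro A B
    obtain ⟨C, hC, h1⟩ := fbeta_exists_aux f β A
    obtain ⟨D, hD, h2⟩ := fbeta_exists_aux f β B
    have hU := Finset.union_subset_union hC hD
    have hI := Finset.inter_subset_inter hC hD
    have h3 := fbeta_le_aux f β hU
    have h4 := fbeta_le_aux f β hI
    have e1 := Finset.sum_sdiff (f := β) hC
    have e2 := Finset.sum_sdiff (f := β) hD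
    have e3 := Finset.sum_sdiff (f := β) hU
    have e4 := Finset.sum_sdiff (f := β) hI
    have e5 := Finset.sum_union_inter (f := β) (s₁ := A) (s₂ := B)
    have e6 := Finset.sum_union_inter (f := β) (s₁ := C) (s₂ := D)
    have := hs C D
    linarith
end

section
/- If f is a rank function on E and β ∈ ℝ_{≥0}^E, then the polymatroidal polyhedron of f_β satisfies P(f_β) = {x ∈ P(f) : x(e) ≤ β(e) for every e ∈ E}. -/
/-- If `f` is a rank function on `E` and `β ∈ ℝ_{≥0}^E`, then
`P(f_β) = {x ∈ P(f) : x(e) ≤ β(e) for every e ∈ E}`. -/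
theorem polyP_fbeta {E : Type*} [Fintype E] [DecidableEq E]
    (f : Finset E → ℝ) (hf : IsRankFunction f) (β : E → ℝ) (hβ : ∀ e, 0 ≤ β e) :
    polyP (fbeta f β) = {x ∈ polyP f | ∀ e, x e ≤ β e} := by
  obtain ⟨h0, -, -, -⟩ := hf
  ext x
  constructor
  · rintro ⟨hx, hA⟩
    have key : ∀ A D : Finset E, D ⊆ A → ∑ e ∈ A, x e ≤ f D + ∑ e ∈ A \ D, β e := by
      intro A D hD
      exact (hA A).trans (Finset.inf'_le (fun D => f D + ∑ e ∈ A \ D, β e)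
        (Finset.mem_powerset.mpr hD))
    refine ⟨⟨hx, fun A => ?_⟩, fun e => ?_⟩
    · simpa using key A A (Finset.Subset.refl A)
    · simpa [h0] using key {e} ∅ (Finset.empty_subset _)
  · rintro ⟨⟨hx, hA⟩, hb⟩
    refine ⟨hx, fun A => ?_⟩
    refine Finset.le_inf' _ _ fun D hD => ?_
    rw [← Finset.sum_sdiff (Finset.mem_powerset.mp hD)]
    have h1 := hA D
    have h2 : ∑ e ∈ A \ D, x e ≤ ∑ e ∈ A \ D, β e := Finset.sum_le_sum fun e _ => hb e
    linarith
end

section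
/- Define x*(i) := C(D_i) − C(D_{i−1}) for i = 1,…,n, where C is the least concave majorant of the points (D_i, E_i). Then x* is feasible (x* ∈ ℝ_{≥0}^n, Σ_{e=1}^l x*(e) ≥ E_l for l = 1,…,n−1, and Σ_{e=1}^n x*(e) = E_n), and for every feasible x one has Σ_{i=1}^n √(x*(i)² + d_i²) ≤ Σ_{i=1}^n √(x(i)² + d_i²); that is, x* minimizes Σ_{i=1}^n √(x(i)² + d_i²) subject to the linear ascending constraints. -/
/-- Partial sum `D_i = ∑_{e=1}^i d_e` (so `D_0 = 0`). -/
noncomputable def Dpt (d : ℕ → ℝ) (i : ℕ) : ℝ := ∑ e ∈ Finset.Icc 1 i, d e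

/-- Partial sum `E_i = ∑_{e=1}^i α_e` (so `E_0 = 0`). -/
noncomputable def Ept (α : ℕ → ℝ) (i : ℕ) : ℝ := ∑ e ∈ Finset.Icc 1 i, α e

/-- The least concave majorant of the points `(D_i, E_i)`, `i = 0,1,…,n`:
`C(u) = inf{g(u) : g concave on [0, D_n] with g(D_i) ≥ E_i for all i}`. -/
noncomputable def leastConcaveMajorant (n : ℕ) (d α : ℕ → ℝ) (u : ℝ) : ℝ :=
  sInf {y : ℝ | ∃ g : ℝ → ℝ, ConcaveOn ℝ (Set.Icc 0 (Dpt d n)) g ∧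
    (∀ i ≤ n, Ept α i ≤ g (Dpt d i)) ∧ y = g u}

/-- Feasibility for the linear ascending constraints: `x ≥ 0`,
`∑_{e=1}^l x(e) ≥ E_l` for `l = 1,…,n−1`, and `∑_{e=1}^n x(e) = E_n`. -/
def TautFeasible (n : ℕ) (α : ℕ → ℝ) (x : ℕ → ℝ) : Prop :=
  (∀ e, 1 ≤ e → e ≤ n → 0 ≤ x e) ∧
  (∀ l, 1 ≤ l → l ≤ n - 1 → Ept α l ≤ ∑ e ∈ Finset.Icc 1 l, x e) ∧
  ∑ e ∈ Finset.Icc 1 n, x e = Ept α n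

namespace TautAux

lemma sum_shift (f : ℕ → ℝ) (n : ℕ) :
    ∑ e ∈ Finset.Icc 1 n, f e = ∑ k ∈ Finset.range n, f (k + 1) := by
  induction n with
  | zero => simp
  | succ m ih => rw [Finset.sum_Icc_succ_top (by omega), ih, Finset.sum_range_succ]

lemma Dpt_zero (d : ℕ → ℝ) : Dpt d 0 = 0 := by simp [Dpt]

lemma Dpt_succ (d : ℕ → ℝ) (k : ℕ) : Dpt d (k + 1) = Dpt d k + d (k + 1) := by
  simp [Dpt, Finset.sum_Icc_succ_top]

lemma Ept_eq (α : ℕ → ℝ) : Ept α = Dpt α := rfl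

lemma Dpt_mono {d : ℕ → ℝ} (hd : ∀ e, 0 ≤ d e) : Monotone (Dpt d) := by
  apply monotone_nat_of_le_succ
  intro k
  rw [Dpt_succ]
  linarith [hd (k + 1)]

lemma three_point {f : ℝ → ℝ} {s : Set ℝ} (hf : ConcaveOn ℝ s f) {x y z : ℝ} (hx : x ∈ s)
    (hz : z ∈ s) (hxy : x ≤ y) (hyz : y ≤ z) :
    (z - y) * f x + (y - x) * f z ≤ (z - x) * f y := by
  rcases eq_or_lt_of_le (hxy.trans hyz) with h | h
  · have h1 : y = x := by linarith
    subst h1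
    subst h
    simp
  · have hp : 0 < z - x := by linarith
    have key := hf.2 hx hz
      (show 0 ≤ (z - y) / (z - x) from div_nonneg (by linarith) hp.le)
      (show 0 ≤ (y - x) / (z - x) from div_nonneg (by linarith) hp.le)
      (by field_simp; ring)
    have e : ((z - y) / (z - x)) • x + ((y - x) / (z - x)) • z = y := by
      simp only [smul_eq_mul]; field_simp; ring
    rw [e] at key
    simp only [smul_eq_mul] at key
    have := mul_le_mul_of_nonneg_left key hp.le
    calc _ = (z - x) * ((z - y) / (z - x) * f x + (y - x) / (z - x) * f z) := by
          field_simp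
      _ ≤ _ := this

section
variable {n : ℕ} {d α : ℕ → ℝ}

lemma maj_nonneg (hd : ∀ e, 0 < d e) (hα : ∀ e, 0 ≤ α e) {g : ℝ → ℝ}
    (hg : ConcaveOn ℝ (Set.Icc 0 (Dpt d n)) g)
    (hm : ∀ i ≤ n, Ept α i ≤ g (Dpt d i)) {u : ℝ} (hu : u ∈ Set.Icc 0 (Dpt d n)) : 0 ≤ g u := by
  have h0 := hm 0 (Nat.zero_le _)
  have h1 := hm n le_rfl
  rw [Ept_eq] at h0 h1
  simp only [Dpt_zero] at h0
  have h2 : 0 ≤ Dpt α n := by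
    rw [← Dpt_zero α]; exact Dpt_mono hα (Nat.zero_le _)
  have hD : (0 : ℝ) ≤ Dpt d n := hu.1.trans hu.2
  have hseg : u ∈ segment ℝ 0 (Dpt d n) := by
    rw [segment_eq_Icc hD]; exact hu
  have := hg.ge_on_segment (Set.left_mem_Icc.2 hD) (Set.right_mem_Icc.2 hD) hseg
  exact (le_min h0 (h2.trans h1)).trans this

lemma lcm_le (hd : ∀ e, 0 < d e) (hα : ∀ e, 0 ≤ α e) {g : ℝ → ℝ}
    (hg : ConcaveOn ℝ (Set.Icc 0 (Dpt d n)) g)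
    (hm : ∀ i ≤ n, Ept α i ≤ g (Dpt d i)) {u : ℝ} (hu : u ∈ Set.Icc 0 (Dpt d n)) :
    leastConcaveMajorant n d α u ≤ g u := by
  apply csInf_le
  · refine ⟨0, ?_⟩
    rintro y ⟨g, h1, h2, rfl⟩
    exact maj_nonneg hd hα h1 h2 hu
  · exact ⟨g, hg, hm, rfl⟩

lemma le_lcm (hα : ∀ e, 0 ≤ α e) {u v : ℝ}
    (h : ∀ g : ℝ → ℝ, ConcaveOn ℝ (Set.Icc 0 (Dpt d n)) g →
      (∀ i ≤ n, Ept α i ≤ g (Dpt d i)) → v ≤ g u) :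
    v ≤ leastConcaveMajorant n d α u := by
  apply le_csInf
  · exact ⟨_, fun _ => Ept α n, concaveOn_const _ (convex_Icc _ _),
      fun i hi => Dpt_mono hα hi, rfl⟩
  · rintro y ⟨g, h1, h2, rfl⟩
    exact h g h1 h2

lemma lcm_concave (hd : ∀ e, 0 < d e) (hα : ∀ e, 0 ≤ α e) :
    ConcaveOn ℝ (Set.Icc 0 (Dpt d n)) (leastConcaveMajorant n d α) := by
  refine ⟨convex_Icc _ _, ?_⟩
  intro x hx y hy a b ha hb hab
  apply le_lcm hα
  intro g hg hm
  refine le_trans ?_ (hg.2 hx hy ha hb hab)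
  simp only [smul_eq_mul]
  have h1 := lcm_le hd hα hg hm hx
  have h2 := lcm_le hd hα hg hm hy
  gcongr

lemma le_lcm_pt (hα : ∀ e, 0 ≤ α e) {i : ℕ} (hi : i ≤ n) :
    Ept α i ≤ leastConcaveMajorant n d α (Dpt d i) :=
  le_lcm hα fun _ _ hm => hm i hi

lemma Dpt_mem (hd : ∀ e, 0 < d e) {i : ℕ} (hi : i ≤ n) : Dpt d i ∈ Set.Icc 0 (Dpt d n) := by
  have hm := Dpt_mono (fun e => (hd e).le)
  refine ⟨?_, hm hi⟩
  rw [← Dpt_zero d]; exact hm (Nat.zero_le _)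

lemma lcm_le_En (hd : ∀ e, 0 < d e) (hα : ∀ e, 0 ≤ α e) {i : ℕ} (hi : i ≤ n) :
    leastConcaveMajorant n d α (Dpt d i) ≤ Ept α n :=
  lcm_le (g := fun _ => Ept α n) hd hα (concaveOn_const _ (convex_Icc _ _))
    (fun _ hi => Dpt_mono hα hi) (Dpt_mem hd hi)

lemma concave_affine (s : Set ℝ) (hs : Convex ℝ s) (a b : ℝ) :
    ConcaveOn ℝ s (fun u => a + b * u) := by
  refine ⟨hs, ?_⟩
  intro x _ y _ p q _ _ hpq
  simp only [smul_eq_mul]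
  have : p = 1 - q := by linarith
  subst this
  apply le_of_eq
  ring

lemma lcm_zero (hd : ∀ e, 0 < d e) (hα : ∀ e, 0 ≤ α e) :
    leastConcaveMajorant n d α (Dpt d 0) = 0 := by
  apply le_antisymm
  · have h := lcm_le (n := n) (u := Dpt d 0) (g := fun u =>
        0 + (∑ e ∈ Finset.Icc 1 n, α e / d e) * u) hd hα
      (concave_affine _ (convex_Icc _ _) _ _) ?_ (Dpt_mem hd (Nat.zero_le _))
    · simpa [Dpt_zero] using h
    · intro i hi
      simp only [Ept, Dpt, zero_add, Finset.mul_sum]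
      apply Finset.sum_le_sum
      intro e he
      rw [← div_le_iff₀ (hd e)]
      refine Finset.single_le_sum (f := fun e => α e / d e)
        (fun j _ => div_nonneg (hα j) (hd j).le) ?_
      simp only [Finset.mem_Icc] at he ⊢
      omega
  · have := le_lcm_pt (d := d) hα (Nat.zero_le n)
    simpa [Ept] using this

/-- Slackness: with slopes `S` of the majorant on both sides of `D_i`. -/
lemma slack (hd : ∀ e, 0 < d e) (hα : ∀ e, 0 ≤ α e) {i : ℕ} (hi : i + 2 ≤ n) {s t : ℝ}
    (hs : leastConcaveMajorant n d α (Dpt d (i + 1)) =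
      leastConcaveMajorant n d α (Dpt d i) + s * d (i + 1))
    (ht : leastConcaveMajorant n d α (Dpt d (i + 2)) =
      leastConcaveMajorant n d α (Dpt d (i + 1)) + t * d (i + 2)) (hst : t < s) :
    leastConcaveMajorant n d α (Dpt d (i + 1)) ≤ Ept α (i + 1) := by
  by_contra! hlt
  have hC := lcm_concave (n := n) hd hα
  have hmono := Dpt_mono (fun e => (hd e).le)
  set C := leastConcaveMajorant n d α with hCdef
  have e1 := Dpt_succ d i
  have e2 : Dpt d (i + 2) = Dpt d (i + 1) + d (i + 2) := Dpt_succ d (i + 1)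
  have p1 := hd (i + 1)
  have p2 := hd (i + 2)
  obtain ⟨m, hm1, hm2⟩ := exists_between hst
  obtain ⟨ε, hε, hεle⟩ : ∃ ε > 0, ε ≤ C (Dpt d (i + 1)) - Ept α (i + 1) ∧
      ε ≤ (m - t) * d (i + 2) ∧ ε ≤ (s - m) * d (i + 1) := by
    refine ⟨min (C (Dpt d (i + 1)) - Ept α (i + 1))
      (min ((m - t) * d (i + 2)) ((s - m) * d (i + 1))), ?_, ?_, ?_, ?_⟩
    · refine lt_min (by linarith) (lt_min (mul_pos (by linarith) p2) (mul_pos (by linarith) p1))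
    · exact min_le_left _ _
    · exact (min_le_right _ _).trans (min_le_left _ _)
    · exact (min_le_right _ _).trans (min_le_right _ _)
  obtain ⟨h1, h2, h3⟩ := hεle
  have h := lcm_le (n := n) (α := α) (u := Dpt d (i + 1)) (g := fun u =>
      (C (Dpt d (i + 1)) - ε - m * Dpt d (i + 1)) + m * u) hd hα
    (concave_affine _ (convex_Icc _ _) _ _) ?_ (Dpt_mem hd (by omega))
  · rw [← hCdef] at h
    linarith
  · intro j hj
    have hEj : Ept α j ≤ C (Dpt d j) := le_lcm_pt hα hj
    rcases lt_trichotomy j (i + 1) with hji | hji | hji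
    · have hle : Dpt d j ≤ Dpt d i := hmono (by omega)
      have tp := three_point hC (Dpt_mem hd hj) (Dpt_mem hd (show i + 1 ≤ n by omega)) hle
        (by linarith)
      have k1 : C (Dpt d j) ≤ C (Dpt d (i + 1)) - s * (Dpt d (i + 1) - Dpt d j) := by
        refine le_of_mul_le_mul_left ?_ p1
        have : C (Dpt d i) = C (Dpt d (i + 1)) - s * d (i + 1) := by linarith
        rw [this, e1] at tp
        rw [e1]
        linarith
      have k2 : (s - m) * d (i + 1) ≤ (s - m) * (Dpt d (i + 1) - Dpt d j) :=
        mul_le_mul_of_nonneg_left (by linarith) (by linarith)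
      linarith
    · subst hji
      linarith
    · have hle : Dpt d (i + 2) ≤ Dpt d j := hmono (by omega)
      have tp := three_point hC (Dpt_mem hd (show i + 1 ≤ n by omega)) (Dpt_mem hd hj)
        (y := Dpt d (i + 2)) (by linarith) hle
      have k1 : C (Dpt d j) ≤ C (Dpt d (i + 1)) + t * (Dpt d j - Dpt d (i + 1)) := by
        refine le_of_mul_le_mul_left ?_ p2
        rw [ht, e2] at tp
        linarith
      have k2 : (m - t) * d (i + 2) ≤ (m - t) * (Dpt d j - Dpt d (i + 1)) :=
        mul_le_mul_of_nonneg_left (by linarith) (by linarith)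
      linarith

end

lemma tangent (x s d : ℝ) (hd : 0 < d) :
    Real.sqrt ((s * d) ^ 2 + d ^ 2) + s / Real.sqrt (1 + s ^ 2) * (x - s * d) ≤
      Real.sqrt (x ^ 2 + d ^ 2) := by
  have hr : 0 < Real.sqrt (1 + s ^ 2) := Real.sqrt_pos.2 (by positivity)
  have hr2 : Real.sqrt (1 + s ^ 2) ^ 2 = 1 + s ^ 2 := Real.sq_sqrt (by positivity)
  have h1 : Real.sqrt ((s * d) ^ 2 + d ^ 2) = d * Real.sqrt (1 + s ^ 2) := by
    rw [show (s * d) ^ 2 + d ^ 2 = d ^ 2 * (1 + s ^ 2) by ring, Real.sqrt_mul (by positivity),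
      Real.sqrt_sq hd.le]
  rw [h1]
  set r := Real.sqrt (1 + s ^ 2)
  have h2 : d * r + s / r * (x - s * d) = (d + s * x) / r := by
    field_simp
    rw [hr2]
    ring
  rw [h2, div_le_iff₀ hr]
  refine (Real.le_sqrt_of_sq_le (y := (x ^ 2 + d ^ 2) * (1 + s ^ 2)) ?_).trans
    (Real.sqrt_mul (by positivity) _).le
  nlinarith [sq_nonneg (x - s * d)]

lemma slope_mono {t s : ℝ} (ht : 0 ≤ t) (hts : t ≤ s) :
    t / Real.sqrt (1 + t ^ 2) ≤ s / Real.sqrt (1 + s ^ 2) := by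
  rw [div_le_div_iff₀ (Real.sqrt_pos.2 (by positivity)) (Real.sqrt_pos.2 (by positivity))]
  have hs : 0 ≤ s := ht.trans hts
  refine le_of_sq_le_sq ?_ (by positivity)
  rw [mul_pow, mul_pow, Real.sq_sqrt (by positivity), Real.sq_sqrt (by positivity)]
  nlinarith [mul_self_le_mul_self ht hts]

lemma abel (p δ : ℕ → ℝ) (h0 : δ 0 = 0) (m : ℕ) :
    ∑ k ∈ Finset.range (m + 1), p k * (δ (k + 1) - δ k) =
      p m * δ (m + 1) + ∑ k ∈ Finset.range m, (p k - p (k + 1)) * δ (k + 1) := by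
  induction m with
  | zero => simp [h0]
  | succ m ih =>
    rw [Finset.sum_range_succ, ih, Finset.sum_range_succ _ m]
    ring

end TautAux

open TautAux in
/-- The taut-string solution `x*(i) = C(D_i) − C(D_{i−1})` is feasible and minimizes
`∑_i √(x(i)² + d_i²)` subject to the linear ascending constraints. -/
theorem tautString_optimal (n : ℕ) (hn : 1 ≤ n) (d α : ℕ → ℝ)
    (hd : ∀ e, 0 < d e) (hα : ∀ e, 0 ≤ α e) :
    let C : ℝ → ℝ := leastConcaveMajorant n d α
    let xstar : ℕ → ℝ := fun i => C (Dpt d i) - C (Dpt d (i - 1))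
    TautFeasible n α xstar ∧
      ∀ x : ℕ → ℝ, TautFeasible n α x →
        ∑ i ∈ Finset.Icc 1 n, Real.sqrt ((xstar i) ^ 2 + (d i) ^ 2) ≤
          ∑ i ∈ Finset.Icc 1 n, Real.sqrt ((x i) ^ 2 + (d i) ^ 2) := by
  intro C xstar
  obtain ⟨m, rfl⟩ : ∃ m, n = m + 1 := ⟨n - 1, by omega⟩
  have hC : ConcaveOn ℝ (Set.Icc 0 (Dpt d (m + 1))) C := lcm_concave hd hα
  have hC0 : C (Dpt d 0) = 0 := lcm_zero hd hα
  have hCE : ∀ i ≤ m + 1, Ept α i ≤ C (Dpt d i) := fun i hi => le_lcm_pt hα hi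
  have hCle : ∀ i ≤ m + 1, C (Dpt d i) ≤ Ept α (m + 1) := fun i hi => lcm_le_En hd hα hi
  have hCn : C (Dpt d (m + 1)) = Ept α (m + 1) := le_antisymm (hCle _ le_rfl) (hCE _ le_rfl)
  have hX : ∀ l, ∑ e ∈ Finset.Icc 1 l, xstar e = C (Dpt d l) := by
    intro l
    rw [sum_shift]
    have : ∀ k, xstar (k + 1) = C (Dpt d (k + 1)) - C (Dpt d k) := fun k => rfl
    simp only [this]
    rw [Finset.sum_range_sub (fun k => C (Dpt d k)), hC0, sub_zero]
  let S : ℕ → ℝ := fun k => (C (Dpt d (k + 1)) - C (Dpt d k)) / d (k + 1)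
  have hS : ∀ k, xstar (k + 1) = S k * d (k + 1) := by
    intro k
    exact (div_mul_cancel₀ _ (hd (k + 1)).ne').symm
  have hS' : ∀ k, C (Dpt d (k + 1)) = C (Dpt d k) + S k * d (k + 1) := by
    intro k
    rw [← hS]
    change _ = C (Dpt d k) + (C (Dpt d (k + 1)) - C (Dpt d k))
    ring
  have hanti : ∀ k, k + 1 ≤ m → S (k + 1) ≤ S k := by
    intro k hk
    have p1 := hd (k + 1)
    have p2 := hd (k + 2)
    have e1 := Dpt_succ d k
    have e2 : Dpt d (k + 2) = Dpt d (k + 1) + d (k + 2) := Dpt_succ d (k + 1)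
    have := hC.slope_anti_adjacent (Dpt_mem hd (show k ≤ m + 1 by omega))
      (Dpt_mem hd (show k + 2 ≤ m + 1 by omega)) (y := Dpt d (k + 1)) (by linarith) (by linarith)
    rw [show Dpt d (k + 2) - Dpt d (k + 1) = d (k + 2) by linarith,
      show Dpt d (k + 1) - Dpt d k = d (k + 1) by linarith] at this
    exact this
  have hSm : 0 ≤ S m := by
    refine div_nonneg ?_ (hd _).le
    have := hCle m (by omega)
    linarith
  have hSnn : ∀ k ≤ m, 0 ≤ S k := by
    intro k hk
    exact Nat.decreasingInduction (motive := fun k _ => 0 ≤ S k)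
      (fun k hk ih => ih.trans (hanti k hk)) hSm hk
  refine ⟨⟨?_, ?_, ?_⟩, ?_⟩
  · intro e h1 h2
    obtain ⟨k, rfl⟩ : ∃ k, e = k + 1 := ⟨e - 1, by omega⟩
    rw [hS]
    exact mul_nonneg (hSnn k (by omega)) (hd _).le
  · intro l _ hl
    rw [hX]
    exact hCE l (by omega)
  · rw [hX, hCn]
  · rintro x ⟨_, hx2, hx3⟩
    rw [sum_shift, sum_shift]
    let p : ℕ → ℝ := fun k => S k / Real.sqrt (1 + S k ^ 2)
    let δ : ℕ → ℝ := fun k => Dpt x k - C (Dpt d k)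
    have hδ0 : δ 0 = 0 := by
      change Dpt x 0 - C (Dpt d 0) = 0
      rw [hC0, Dpt_zero, sub_zero]
    have hδn : δ (m + 1) = 0 := by
      change Dpt x (m + 1) - C (Dpt d (m + 1)) = 0
      rw [hCn]
      exact sub_eq_zero.2 hx3
    have key : 0 ≤ ∑ k ∈ Finset.range (m + 1), p k * (δ (k + 1) - δ k) := by
      rw [abel p δ hδ0, hδn, mul_zero, zero_add]
      apply Finset.sum_nonneg
      intro k hk
      have hk : k < m := Finset.mem_range.1 hk
      rcases eq_or_lt_of_le (hanti k hk) with h | h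
      · have : p k - p (k + 1) = 0 := by simp only [p, h, sub_self]
        rw [this, zero_mul]
      · refine mul_nonneg (sub_nonneg.2 (slope_mono (hSnn _ hk) h.le)) ?_
        have h1 : C (Dpt d (k + 1)) ≤ Ept α (k + 1) :=
          slack hd hα (by omega) (hS' k) (hS' (k + 1)) h
        have h2 : Ept α (k + 1) ≤ Dpt x (k + 1) := hx2 (k + 1) (by omega) (by omega)
        exact sub_nonneg.2 (h1.trans h2)
    have hsum : ∑ k ∈ Finset.range (m + 1), (Real.sqrt (xstar (k + 1) ^ 2 + d (k + 1) ^ 2) +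
        p k * (δ (k + 1) - δ k)) ≤
        ∑ k ∈ Finset.range (m + 1), Real.sqrt (x (k + 1) ^ 2 + d (k + 1) ^ 2) := by
      apply Finset.sum_le_sum
      intro k _
      have h1 : δ (k + 1) - δ k = x (k + 1) - S k * d (k + 1) := by
        change Dpt x (k + 1) - C (Dpt d (k + 1)) - (Dpt x k - C (Dpt d k)) = _
        rw [Dpt_succ, hS' k]
        ring
      rw [h1, hS]
      exact tangent _ _ _ (hd _)
    rw [Finset.sum_add_distrib] at hsum
    linarith
end

section
/- Define x*(i) := C(D_i) − C(D_{i−1}) for i = 1,…,n, where C is the least concave majorant of the points (D_i, E_i). Then for every strictly convex, continuously differentiable φ : ℝ_{≥0} → ℝ, x* minimizes the d-separable objective Σ_{i=1}^n d_i · φ(x(i)/d_i) over all feasible x (x ∈ ℝ_{≥0}^n with Σ_{e=1}^l x(e) ≥ E_l for l = 1,…,n−1 and Σ_{e=1}^n x(e) = E_n). -/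
lemma Dpt_zero (d : ℕ → ℝ) : Dpt d 0 = 0 := by simp [Dpt]

lemma Dpt_succ (d : ℕ → ℝ) (i : ℕ) : Dpt d (i + 1) = Dpt d i + d (i + 1) := by
  unfold Dpt
  rw [Finset.sum_Icc_succ_top (by omega)]

lemma Dpt_mono (d : ℕ → ℝ) (hd : ∀ e, 0 ≤ d e) : Monotone (Dpt d) :=
  monotone_nat_of_le_succ fun i => by rw [Dpt_succ]; linarith [hd (i + 1)]

lemma Ept_eq_Dpt : Ept = Dpt := rfl

/-- The class of concave majorants. -/
def Maj (n : ℕ) (d α : ℕ → ℝ) (g : ℝ → ℝ) : Prop :=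
  ConcaveOn ℝ (Set.Icc 0 (Dpt d n)) g ∧ (∀ i ≤ n, Ept α i ≤ g (Dpt d i))

section
variable {n : ℕ} {d α : ℕ → ℝ}

lemma Dpt_mem (hd : ∀ e, 0 < d e) {i : ℕ} (hi : i ≤ n) :
    Dpt d i ∈ Set.Icc 0 (Dpt d n) := by
  have := Dpt_mono d fun e => (hd e).le
  exact ⟨by simpa [Dpt_zero] using this (Nat.zero_le i), this hi⟩

lemma Maj.nonneg (hα : ∀ e, 0 ≤ α e) {g : ℝ → ℝ} (hg : Maj n d α g)
    {u : ℝ} (hu : u ∈ Set.Icc 0 (Dpt d n)) : 0 ≤ g u := by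
  have hE : ∀ i, 0 ≤ Ept α i := fun i => Finset.sum_nonneg fun e _ => hα e
  have h0 := hg.2 0 (Nat.zero_le _)
  have h1 := hg.2 n le_rfl
  rw [Dpt_zero] at h0
  have hD : (0 : ℝ) ≤ Dpt d n := hu.1.trans hu.2
  have := hg.1.min_le_of_mem_Icc (Set.left_mem_Icc.2 hD) (Set.right_mem_Icc.2 hD) hu
  exact le_trans (le_min ((hE 0).trans h0) ((hE n).trans h1)) this

lemma lcm_le (hα : ∀ e, 0 ≤ α e) {g : ℝ → ℝ} (hg : Maj n d α g)
    {u : ℝ} (hu : u ∈ Set.Icc 0 (Dpt d n)) : leastConcaveMajorant n d α u ≤ g u := by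
  apply csInf_le
  · refine ⟨0, ?_⟩
    rintro y ⟨g', h1, h2, rfl⟩
    exact Maj.nonneg hα ⟨h1, h2⟩ hu
  · exact ⟨g, hg.1, hg.2, rfl⟩

lemma maj_const (hα : ∀ e, 0 ≤ α e) : Maj n d α (fun _ => Ept α n) :=
  ⟨concaveOn_const _ (convex_Icc _ _), fun _ hi => Dpt_mono α hα hi⟩

lemma le_lcm (hα : ∀ e, 0 ≤ α e) {u a : ℝ} (h : ∀ g, Maj n d α g → a ≤ g u) :
    a ≤ leastConcaveMajorant n d α u := by
  apply le_csInf
  · exact ⟨_, _, (maj_const (d := d) hα).1, (maj_const (d := d) hα).2, rfl⟩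
  · rintro y ⟨g', h1, h2, rfl⟩
    exact h g' ⟨h1, h2⟩

lemma maj_lcm (hα : ∀ e, 0 ≤ α e) : Maj n d α (leastConcaveMajorant n d α) := by
  refine ⟨⟨convex_Icc _ _, ?_⟩, fun i hi => le_lcm hα fun g hg => hg.2 i hi⟩
  intro x hx y hy a b ha hb hab
  refine le_lcm hα fun g hg => le_trans ?_ (hg.1.2 hx hy ha hb hab)
  have h1 := lcm_le hα hg hx
  have h2 := lcm_le hα hg hy
  simp only [smul_eq_mul]
  gcongr

lemma lcm_zero (hd : ∀ e, 0 < d e) (hα : ∀ e, 0 ≤ α e) :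
    leastConcaveMajorant n d α 0 = 0 := by
  have h0 : (0 : ℝ) ∈ Set.Icc 0 (Dpt d n) := by
    simpa [Dpt_zero] using Dpt_mem (n := n) hd (Nat.zero_le n)
  have hE : ∀ i, 0 ≤ Ept α i := fun i => Finset.sum_nonneg fun e _ => hα e
  apply le_antisymm _ (Maj.nonneg hα (maj_lcm hα) h0)
  have hm : Maj n d α (fun u => if u = 0 then 0 else Ept α n) := by
    refine ⟨⟨convex_Icc _ _, ?_⟩, ?_⟩
    · intro x hx y hy a b ha hb hab
      have hEn := hE n
      simp only [smul_eq_mul]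
      by_cases hz : a * x + b * y = 0
      · rw [if_pos hz]
        have h1 := mul_nonneg ha hx.1
        have h2 := mul_nonneg hb hy.1
        have h3 : a * x = 0 := by linarith
        have h4 : b * y = 0 := by linarith
        rcases mul_eq_zero.1 h3 with h | h <;> rcases mul_eq_zero.1 h4 with h' | h' <;> simp [h, h']
      · rw [if_neg hz]
        have h1 : (if x = 0 then 0 else Ept α n) ≤ Ept α n := by split_ifs <;> simp [hEn]
        have h2 : (if y = 0 then 0 else Ept α n) ≤ Ept α n := by split_ifs <;> simp [hEn]
        nlinarith [mul_le_mul_of_nonneg_left h1 ha, mul_le_mul_of_nonneg_left h2 hb]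
    · intro i hi
      rcases Nat.eq_zero_or_pos i with rfl | hpos
      · simp [Dpt_zero, Ept_eq_Dpt]
      · have : 0 < Dpt d i := Finset.sum_pos (fun e _ => hd e) ⟨1, by simp; omega⟩
        simp only [this.ne', if_false]
        exact Dpt_mono α hα hi
  simpa using lcm_le hα hm h0

lemma lcm_top (hd : ∀ e, 0 < d e) (hα : ∀ e, 0 ≤ α e) :
    leastConcaveMajorant n d α (Dpt d n) = Ept α n :=
  le_antisymm (lcm_le hα (maj_const hα) (Dpt_mem hd le_rfl)) ((maj_lcm hα).2 n le_rfl)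

lemma lcm_mono_step (hd : ∀ e, 0 < d e) (hα : ∀ e, 0 ≤ α e) {i : ℕ} (hi : i + 1 ≤ n) :
    leastConcaveMajorant n d α (Dpt d i) ≤ leastConcaveMajorant n d α (Dpt d (i + 1)) := by
  set C := leastConcaveMajorant n d α
  have hm : ∀ {j}, j ≤ n → Dpt d j ∈ Set.Icc 0 (Dpt d n) := fun h => Dpt_mem hd h
  have h1 : C (Dpt d i) ≤ C (Dpt d n) := by
    have ht : C (Dpt d n) = Ept α n := lcm_top hd hα
    rw [ht]
    exact lcm_le hα (maj_const hα) (hm (by omega))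
  have hmono := Dpt_mono d fun e => (hd e).le
  have := (maj_lcm (n := n) (d := d) hα).1.min_le_of_mem_Icc
    (hm (show i ≤ n by omega)) (hm le_rfl)
    (z := Dpt d (i + 1)) ⟨hmono (by omega), hmono hi⟩
  rwa [min_eq_left h1] at this

/-- Chord slopes from concavity, cross-multiplied. -/
lemma chord {s : Set ℝ} {f : ℝ → ℝ} (hf : ConcaveOn ℝ s f) {x y z : ℝ} (hx : x ∈ s) (hz : z ∈ s)
    (hxy : x < y) (hyz : y < z) : (f z - f y) * (y - x) ≤ (f y - f x) * (z - y) := by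
  have := hf.slope_anti_adjacent hx hz hxy hyz
  rwa [div_le_div_iff₀ (by linarith) (by linarith)] at this

/-- The taut property. -/
lemma taut (hd : ∀ e, 0 < d e) (hα : ∀ e, 0 ≤ α e) {l : ℕ} (hl : l + 2 ≤ n)
    {s t : ℝ}
    (hs : leastConcaveMajorant n d α (Dpt d (l + 1)) - leastConcaveMajorant n d α (Dpt d l)
      = s * d (l + 1))
    (ht : leastConcaveMajorant n d α (Dpt d (l + 2)) - leastConcaveMajorant n d α (Dpt d (l + 1))
      = t * d (l + 2)) (hts : t < s) :
    leastConcaveMajorant n d α (Dpt d (l + 1)) = Ept α (l + 1) := by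
  have hM := maj_lcm (n := n) (d := d) hα
  set C := leastConcaveMajorant n d α with hC
  have hm : ∀ {j}, j ≤ n → Dpt d j ∈ Set.Icc 0 (Dpt d n) := fun h => Dpt_mem hd h
  have hmono := Dpt_mono d fun e => (hd e).le
  have hsm : StrictMono (Dpt d) := strictMono_nat_of_lt_succ fun i => by
    rw [Dpt_succ]; linarith [hd (i + 1)]
  have e1 := Dpt_succ d l
  have e2 : Dpt d (l + 2) = Dpt d (l + 1) + d (l + 2) := Dpt_succ d (l + 1)
  have p1 := hd (l + 1)
  have p2 := hd (l + 2)
  by_contra hne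
  have hlt : Ept α (l + 1) < C (Dpt d (l + 1)) := lt_of_le_of_ne (hM.2 _ (by omega)) (Ne.symm hne)
  obtain ⟨m, hm1, hm2⟩ := exists_between hts
  obtain ⟨ε, hε, hε'⟩ : ∃ ε > 0, ε ≤ C (Dpt d (l + 1)) - Ept α (l + 1) ∧
      ε ≤ (m - t) * d (l + 2) ∧ ε ≤ (s - m) * d (l + 1) := by
    refine ⟨min (C (Dpt d (l + 1)) - Ept α (l + 1)) (min ((m - t) * d (l + 2)) ((s - m) * d (l + 1))),
      lt_min (by linarith) (lt_min (mul_pos (by linarith) p2) (mul_pos (by linarith) p1)), ?_⟩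
    simp
  obtain ⟨hε1, hε2, hε3⟩ := hε'
  have hL : ConcaveOn ℝ (Set.Icc 0 (Dpt d n))
      (fun u => C (Dpt d (l + 1)) - ε + m * (u - Dpt d (l + 1))) := by
    refine ⟨convex_Icc _ _, fun x _ y _ a b _ _ hab => le_of_eq ?_⟩
    obtain rfl : b = 1 - a := by linarith
    simp only [smul_eq_mul]
    ring
  have hg : Maj n d α
      (C ⊓ fun u => C (Dpt d (l + 1)) - ε + m * (u - Dpt d (l + 1))) := by
    refine ⟨hM.1.inf hL, fun j hj => le_min (hM.2 j hj) ?_⟩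
    rcases lt_trichotomy j (l + 1) with h | rfl | h
    · refine (hM.2 j hj).trans ?_
      have hj1 : Dpt d j ≤ Dpt d l := hmono (by omega)
      have key : C (Dpt d j) ≤ C (Dpt d l) - s * (Dpt d l - Dpt d j) := by
        rcases hj1.eq_or_lt with h' | h'
        · rw [h']; simp
        · have := chord hM.1 (hm hj) (hm (show l + 1 ≤ n by omega)) h' (hsm (Nat.lt_succ_self l))
          rw [hs, e1] at this
          have h3 : s * (Dpt d l - Dpt d j) ≤ C (Dpt d l) - C (Dpt d j) := by
            refine le_of_mul_le_mul_right ?_ p1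
            linarith
          linarith
      have e3 : m * (Dpt d j - Dpt d (l + 1)) = m * (Dpt d j - Dpt d l) - m * d (l + 1) := by
        rw [e1]; ring
      beta_reduce
      rw [e3]
      nlinarith [mul_nonneg (sub_nonneg.2 hm2.le) (sub_nonneg.2 hj1)]
    · simp only [sub_self, mul_zero]; linarith
    · refine (hM.2 j hj).trans ?_
      have hj1 : Dpt d (l + 2) ≤ Dpt d j := hmono (by omega)
      have key : C (Dpt d j) ≤ C (Dpt d (l + 2)) + t * (Dpt d j - Dpt d (l + 2)) := by
        rcases hj1.eq_or_lt with h' | h'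
        · rw [h']; simp
        · have := chord hM.1 (hm (show l + 1 ≤ n by omega)) (hm hj) (hsm (Nat.lt_succ_self (l + 1))) h'
          rw [ht, e2] at this
          have h3 : C (Dpt d j) - C (Dpt d (l + 2)) ≤ t * (Dpt d j - Dpt d (l + 2)) := by
            refine le_of_mul_le_mul_right ?_ p2
            rw [e2]
            linarith
          linarith
      have e3 : m * (Dpt d j - Dpt d (l + 1)) = m * (Dpt d j - Dpt d (l + 2)) + m * d (l + 2) := by
        rw [e2]; ring
      beta_reduce
      rw [e3]
      nlinarith [mul_nonneg (sub_nonneg.2 hm1.le) (sub_nonneg.2 hj1)]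
  have := lcm_le hα hg (hm (show l + 1 ≤ n by omega))
  have h2 := this.trans (min_le_right _ _)
  simp only [sub_self, mul_zero, ← hC] at h2
  linarith

end

/-- Gradient inequality on `[0,∞)`. -/
lemma grad {φ : ℝ → ℝ} (hφ : ConvexOn ℝ (Set.Ici 0) φ) (hc : DifferentiableOn ℝ φ (Set.Ici 0))
    {s y : ℝ} (hs : 0 ≤ s) (hy : 0 ≤ y) :
    φ s + derivWithin φ (Set.Ici 0) s * (y - s) ≤ φ y := by
  rcases lt_trichotomy s y with h | rfl | h
  · have := hφ.derivWithin_le_slope hs hy h (hc s hs)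
    rw [slope_def_field, le_div_iff₀ (by linarith)] at this
    linarith
  · simp
  · have := hφ.slope_le_derivWithin hy hs h (hc s hs)
    rw [slope_def_field, div_le_iff₀ (by linarith)] at this
    linarith

lemma abel (p z : ℕ → ℝ) (m : ℕ)
    (h : ∀ l, 1 ≤ l → l ≤ m → 0 ≤ (p l - p (l + 1)) * ∑ e ∈ Finset.Icc 1 l, z e) :
    p (m + 1) * ∑ e ∈ Finset.Icc 1 (m + 1), z e ≤ ∑ e ∈ Finset.Icc 1 (m + 1), p e * z e := by
  induction m with
  | zero => simp
  | succ m ih =>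
    have h1 := ih fun l h1 h2 => h l h1 (by omega)
    have h2 := h (m + 1) (by omega) le_rfl
    rw [Finset.sum_Icc_succ_top (by omega), Finset.sum_Icc_succ_top (by omega) (fun e => p e * z e)]
    nlinarith

/-- The taut-string solution `x*(i) = C(D_i) − C(D_{i−1})` minimizes every
`d`-separable objective `∑_i d_i · φ(x(i)/d_i)`, for `φ` strictly convex and
continuously differentiable, over all feasible `x`. -/
theorem tautString_optimal_dSeparable (n : ℕ) (hn : 1 ≤ n) (d α : ℕ → ℝ)
    (hd : ∀ e, 0 < d e) (hα : ∀ e, 0 ≤ α e) :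
    let C : ℝ → ℝ := leastConcaveMajorant n d α
    let xstar : ℕ → ℝ := fun i => C (Dpt d i) - C (Dpt d (i - 1))
    ∀ φ : ℝ → ℝ, StrictConvexOn ℝ (Set.Ici 0) φ → ContDiffOn ℝ 1 φ (Set.Ici 0) →
      TautFeasible n α xstar ∧
      ∀ x : ℕ → ℝ, TautFeasible n α x →
        ∑ i ∈ Finset.Icc 1 n, d i * φ (xstar i / d i) ≤
          ∑ i ∈ Finset.Icc 1 n, d i * φ (x i / d i) := by

  intro C xstar φ hφ hcd
  have hM : Maj n d α C := maj_lcm hα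
  have hDm : ∀ {j}, j ≤ n → Dpt d j ∈ Set.Icc 0 (Dpt d n) := fun h => Dpt_mem hd h
  have hsm : StrictMono (Dpt d) := strictMono_nat_of_lt_succ fun i => by
    rw [Dpt_succ]; linarith [hd (i + 1)]
  have hsum : ∀ l, ∑ e ∈ Finset.Icc 1 l, xstar e = C (Dpt d l) := by
    intro l
    induction l with
    | zero => simp [Dpt_zero, C, lcm_zero hd hα]
    | succ l ih =>
      rw [Finset.sum_Icc_succ_top (by omega), ih]
      simp [xstar]
  have hnn : ∀ e, 1 ≤ e → e ≤ n → 0 ≤ xstar e := by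
    intro e h1 h2
    obtain ⟨i, rfl⟩ : ∃ i, e = i + 1 := ⟨e - 1, by omega⟩
    have := lcm_mono_step hd hα h2
    simpa [xstar] using this
  have hfeas : TautFeasible n α xstar := by
    refine ⟨hnn, fun l h1 h2 => ?_, ?_⟩
    · rw [hsum]; exact hM.2 l (by omega)
    · rw [hsum]; exact lcm_top hd hα
  refine ⟨hfeas, fun x hx => ?_⟩
  have hdiff := hcd.differentiableOn one_ne_zero
  set s : ℕ → ℝ := fun i => xstar i / d i with hs
  set p : ℕ → ℝ := fun i => derivWithin φ (Set.Ici 0) (s i) with hp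
  have hsnn : ∀ e, 1 ≤ e → e ≤ n → 0 ≤ s e := fun e h1 h2 => div_nonneg (hnn e h1 h2) (hd e).le
  have hsd : ∀ e, xstar e = s e * d e := fun e => by
    simp only [hs]; rw [div_mul_cancel₀ _ (hd e).ne']
  have hdist : ∀ l, ∑ e ∈ Finset.Icc 1 l, (x e - xstar e)
      = ∑ e ∈ Finset.Icc 1 l, x e - C (Dpt d l) := fun l => by
    rw [Finset.sum_sub_distrib, hsum]
  obtain ⟨m, rfl⟩ : ∃ m, n = m + 1 := ⟨n - 1, by omega⟩
  have hab := abel p (fun e => x e - xstar e) m (by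
    intro l h1 h2
    obtain ⟨k, rfl⟩ : ∃ k, l = k + 1 := ⟨l - 1, by omega⟩
    have hanti : s (k + 2) ≤ s (k + 1) := by
      have := hM.1.slope_anti_adjacent (hDm (show k ≤ m + 1 by omega))
        (hDm (show k + 2 ≤ m + 1 by omega)) (hsm (Nat.lt_succ_self k)) (hsm (Nat.lt_succ_self (k + 1)))
      have e1 : Dpt d (k + 1) - Dpt d k = d (k + 1) := by rw [Dpt_succ]; ring
      have e2 : Dpt d (k + 2) - Dpt d (k + 1) = d (k + 2) := by rw [Dpt_succ d (k + 1)]; ring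
      simp only [Nat.succ_eq_add_one] at this
      rw [e1, e2] at this
      simpa [hs, xstar] using this
    rcases hanti.eq_or_lt with he | hlt
    · have : p (k + 1) = p (k + 1 + 1) := by simp only [hp]; rw [← he]
      rw [this]; simp
    · have ht : C (Dpt d (k + 1)) = Ept α (k + 1) :=
        taut hd hα (show k + 2 ≤ m + 1 by omega) (hsd (k + 1)) (hsd (k + 2)) hlt
      apply mul_nonneg
      · have a1 := hsnn (k + 1) (by omega) (by omega)
        have a2 := hsnn (k + 2) (by omega) (by omega)
        have g1 := grad hφ.convexOn hdiff a1 a2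
        have g2 := grad hφ.convexOn hdiff a2 a1
        change 0 ≤ derivWithin φ (Set.Ici 0) (s (k + 1)) - derivWithin φ (Set.Ici 0) (s (k + 2))
        refine le_of_mul_le_mul_right ?_ (sub_pos.2 hlt)
        linarith
      · rw [hdist, ht]
        linarith [hx.2.1 (k + 1) (by omega) (by omega)])
  have hz : C (Dpt d (m + 1)) = Ept α (m + 1) := lcm_top hd hα
  rw [hdist, hx.2.2, hz, sub_self, mul_zero] at hab
  have hterm : ∑ i ∈ Finset.Icc 1 (m + 1), (d i * φ (s i) + p i * (x i - xstar i)) ≤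
      ∑ i ∈ Finset.Icc 1 (m + 1), d i * φ (x i / d i) := by
    apply Finset.sum_le_sum
    intro i hi
    rw [Finset.mem_Icc] at hi
    have hdi := hd i
    have g := grad hφ.convexOn hdiff (hsnn i hi.1 hi.2) (div_nonneg (hx.1 i hi.1 hi.2) hdi.le)
    have g' := mul_le_mul_of_nonneg_left g hdi.le
    refine le_trans (le_of_eq ?_) g'
    have e : x i = d i * (x i / d i) := by field_simp
    have : x i - xstar i = d i * (x i / d i - s i) := by rw [hsd i, mul_sub, ← e]; ring
    rw [this]
    simp only [hp]; ring
  rw [Finset.sum_add_distrib] at hterm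
  change ∑ i ∈ Finset.Icc 1 (m + 1), d i * φ (s i) ≤ _
  linarith
end

section
/- Fix indices 1 ≤ l ≤ m ≤ n and reals α(e) for l ≤ e ≤ m. There exists η ∈ ℝ satisfying Σ_{e=l}^{m} H_e^-(η) ≤ Σ_{e=l}^{m} α(e) ≤ Σ_{e=l}^{m} H_e^+(η) if and only if 0 ≤ Σ_{e=l}^{m} α(e) ≤ Σ_{e=l}^{m} β(e). -/
/-- Right derivative `w⁺(ζ)` of `w : [0, b] → ℝ` at `ζ` (derivative from within `[ζ, b]`). -/
noncomputable def wplus (b : ℝ) (w : ℝ → ℝ) (ζ : ℝ) : ℝ := derivWithin w (Set.Icc ζ b) ζ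

/-- Left derivative `w⁻(ζ)` of `w : [0, b] → ℝ` at `ζ` (derivative from within `[0, ζ]`). -/
noncomputable def wminus (w : ℝ → ℝ) (ζ : ℝ) : ℝ := derivWithin w (Set.Icc 0 ζ) ζ

/-- `i⁻(η) = inf{ζ : w⁺(ζ) ≥ η}` (over the domain `[0, b]`). -/
noncomputable def iminus (b : ℝ) (w : ℝ → ℝ) (η : ℝ) : ℝ :=
  sInf {ζ | ζ ∈ Set.Icc 0 b ∧ η ≤ wplus b w ζ}

/-- `i⁺(η) = sup{ζ : w⁻(ζ) ≤ η}` (over the domain `[0, b]`). -/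
noncomputable def iplus (b : ℝ) (w : ℝ → ℝ) (η : ℝ) : ℝ :=
  sSup {ζ | ζ ∈ Set.Icc 0 b ∧ wminus w ζ ≤ η}

/-- The saturated-truncated inverse `H⁻`. -/
noncomputable def Hminus (b : ℝ) (w : ℝ → ℝ) (η : ℝ) : ℝ :=
  if η ≤ wplus b w 0 then 0
  else if η ≤ wminus w b then iminus b w η
  else b

/-- The saturated-truncated inverse `H⁺`. -/
noncomputable def Hplus (b : ℝ) (w : ℝ → ℝ) (η : ℝ) : ℝ :=
  if η < wplus b w 0 then 0
  else if η < wminus w b then iplus b w η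
  else b


open Filter Topology in
lemma wminus_eq_left (w : ℝ → ℝ) {ζ : ℝ} (h : 0 < ζ) :
    wminus w ζ = derivWithin w (Set.Iio ζ) ζ := by
  unfold wminus
  apply derivWithin_congr_set' ζ
  rw [Filter.eventuallyEq_set, eventually_nhdsWithin_iff]
  filter_upwards [lt_mem_nhds h] with x hx hne
  simp only [Set.mem_Icc, Set.mem_Iio]
  constructor
  · rintro ⟨_, h2⟩
    exact lt_of_le_of_ne h2 hne
  · intro h2
    exact ⟨hx.le, h2.le⟩

open Filter Topology in
lemma wplus_eq_right (w : ℝ → ℝ) {b ζ : ℝ} (h : ζ < b) :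
    wplus b w ζ = derivWithin w (Set.Ioi ζ) ζ := by
  unfold wplus
  apply derivWithin_congr_set' ζ
  rw [Filter.eventuallyEq_set, eventually_nhdsWithin_iff]
  filter_upwards [gt_mem_nhds h] with x hx hne
  simp only [Set.mem_Icc, Set.mem_Ioi]
  constructor
  · rintro ⟨h2, _⟩
    exact lt_of_le_of_ne h2 (fun h => hne h.symm)
  · intro h2
    exact ⟨h2.le, hx.le⟩

lemma wminus_le_wplus {w : ℝ → ℝ} {b ζ : ℝ} (hw : ConvexOn ℝ (Set.Icc 0 b) w)
    (h0 : 0 < ζ) (hb : ζ < b) : wminus w ζ ≤ wplus b w ζ := by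
  rw [wminus_eq_left w h0, wplus_eq_right w hb]
  apply hw.leftDeriv_le_rightDeriv_of_mem_interior
  rw [interior_Icc]
  exact ⟨h0, hb⟩

lemma wminus_mono {w : ℝ → ℝ} {b x y : ℝ} (hw : ConvexOn ℝ (Set.Icc 0 b) w)
    (h0 : 0 < x) (hxy : x ≤ y) (hb : y < b) : wminus w x ≤ wminus w y := by
  rw [wminus_eq_left w h0, wminus_eq_left w (h0.trans_le hxy)]
  have := hw.monotoneOn_leftDeriv
  rw [interior_Icc] at this
  exact this ⟨h0, hxy.trans_lt hb⟩ ⟨h0.trans_le hxy, hb⟩ hxy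

lemma iplus_nonneg (b : ℝ) (w : ℝ → ℝ) (η : ℝ) : 0 ≤ iplus b w η :=
  Real.sSup_nonneg (fun _ hx => hx.1.1)

lemma iplus_le {b : ℝ} (hb : 0 < b) (w : ℝ → ℝ) (η : ℝ) : iplus b w η ≤ b :=
  Real.sSup_le (fun _ hx => hx.1.2) hb.le

lemma le_iplus {b : ℝ} {w : ℝ → ℝ} {η ζ : ℝ} (h : ζ ∈ Set.Icc 0 b) (h2 : wminus w ζ ≤ η) :
    ζ ≤ iplus b w η :=
  le_csSup ⟨b, fun _ hx => hx.1.2⟩ ⟨h, h2⟩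

lemma iminus_nonneg (b : ℝ) (w : ℝ → ℝ) (η : ℝ) : 0 ≤ iminus b w η :=
  Real.sInf_nonneg (fun _ hx => hx.1.1)

lemma iminus_le {b : ℝ} {w : ℝ → ℝ} {η ζ : ℝ} (h : ζ ∈ Set.Icc 0 b) (h2 : η ≤ wplus b w ζ) :
    iminus b w η ≤ ζ :=
  csInf_le ⟨0, fun _ hx => hx.1.1⟩ ⟨h, h2⟩

lemma iminus_le_b {b : ℝ} (hb : 0 < b) (w : ℝ → ℝ) (η : ℝ) : iminus b w η ≤ b := by
  rcases Set.eq_empty_or_nonempty {ζ | ζ ∈ Set.Icc 0 b ∧ η ≤ wplus b w ζ} with h | ⟨x, hx⟩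
  · unfold iminus
    rw [h, Real.sInf_empty]
    exact hb.le
  · exact (iminus_le hx.1 hx.2).trans hx.1.2

lemma Hplus_nonneg {b : ℝ} (hb : 0 < b) (w : ℝ → ℝ) (η : ℝ) : 0 ≤ Hplus b w η := by
  unfold Hplus
  split_ifs
  · exact le_rfl
  · exact iplus_nonneg _ _ _
  · exact hb.le

lemma Hplus_le {b : ℝ} (hb : 0 < b) (w : ℝ → ℝ) (η : ℝ) : Hplus b w η ≤ b := by
  unfold Hplus
  split_ifs
  · exact hb.le
  · exact iplus_le hb _ _
  · exact le_rfl

lemma Hminus_nonneg {b : ℝ} (hb : 0 < b) (w : ℝ → ℝ) (η : ℝ) : 0 ≤ Hminus b w η := by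
  unfold Hminus
  split_ifs
  · exact le_rfl
  · exact iminus_nonneg _ _ _
  · exact hb.le

open Filter Topology in
lemma Hplus_right {b : ℝ} (hb : 0 < b) {w : ℝ → ℝ} (hw : ConvexOn ℝ (Set.Icc 0 b) w)
    (η : ℝ) {ε : ℝ} (hε : 0 < ε) :
    ∀ᶠ η' in 𝓝[≥] η, Hplus b w η' ≤ Hplus b w η + ε := by
  by_cases h1 : η < wplus b w 0
  · filter_upwards [mem_nhdsWithin_of_mem_nhds (gt_mem_nhds h1)] with x hx
    have hx : x < wplus b w 0 := hx
    simp only [Hplus, h1, hx, if_true]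
    linarith
  by_cases h2 : η < wminus w b
  · by_cases h3 : b ≤ iplus b w η + ε
    · refine Eventually.of_forall fun x => (Hplus_le hb w x).trans ?_
      simpa only [Hplus, h1, h2, if_true, if_false] using h3
    · push Not at h3
      have hz0 := iplus_nonneg b w η
      have h4 : η < wminus w (iplus b w η + ε) := by
        by_contra h
        push Not at h
        have := le_iplus (b := b) (ζ := iplus b w η + ε) ⟨by linarith, h3.le⟩ h
        linarith
      filter_upwards [mem_nhdsWithin_of_mem_nhds (gt_mem_nhds h2),
        mem_nhdsWithin_of_mem_nhds (gt_mem_nhds h4), self_mem_nhdsWithin] with x hx2 hx4 hx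
      have hx2 : x < wminus w b := hx2
      have hx4 : x < wminus w (iplus b w η + ε) := hx4
      have hx : η ≤ x := hx
      have hx1 : ¬ x < wplus b w 0 := fun h => h1 (hx.trans_lt h)
      simp only [Hplus, h1, h2, hx1, hx2, if_true, if_false]
      refine Real.sSup_le ?_ (by linarith)
      rintro y ⟨⟨_, hyb⟩, hy⟩
      by_contra! hlt
      rcases hyb.lt_or_eq with h | h
      · have := wminus_mono hw (by linarith) hlt.le h
        linarith
      · rw [h] at hy
        linarith
  · refine Eventually.of_forall fun x => (Hplus_le hb w x).trans ?_
    simp only [Hplus, h1, h2, if_false]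
    linarith

open Filter Topology in
lemma Hminus_left {b : ℝ} (hb : 0 < b) {w : ℝ → ℝ} (hw : ConvexOn ℝ (Set.Icc 0 b) w)
    (η : ℝ) {ε : ℝ} (hε : 0 < ε) :
    ∀ᶠ η' in 𝓝[<] η, Hminus b w η ≤ Hplus b w η' + ε := by
  by_cases h1 : η ≤ wplus b w 0
  · refine Eventually.of_forall fun x => ?_
    have := Hplus_nonneg hb w x
    simp only [Hminus, h1, if_true]
    linarith
  have h1' : wplus b w 0 < η := not_le.mp h1
  by_cases h2 : η ≤ wminus w b
  · by_cases h3 : iminus b w η ≤ ε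
    · refine Eventually.of_forall fun x => ?_
      have := Hplus_nonneg hb w x
      simp only [Hminus, h1, h2, if_true, if_false]
      linarith
    · push Not at h3
      obtain ⟨ζ, hζ1, hζ2⟩ := exists_between (show iminus b w η - ε < iminus b w η by linarith)
      have hζb : ζ < b := hζ2.trans_le (iminus_le_b hb w η)
      have hζ0 : 0 < ζ := by linarith
      have h4 : wplus b w ζ < η := by
        by_contra! h
        have := iminus_le (b := b) (ζ := ζ) ⟨hζ0.le, hζb.le⟩ h
        linarith
      have h5 := (wminus_le_wplus hw hζ0 hζb).trans_lt h4
      filter_upwards [mem_nhdsWithin_of_mem_nhds (lt_mem_nhds h1'),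
        mem_nhdsWithin_of_mem_nhds (lt_mem_nhds h5), self_mem_nhdsWithin] with x hx1 hx5 hx
      have hx1 : wplus b w 0 < x := hx1
      have hx5 : wminus w ζ < x := hx5
      have hx : x < η := hx
      have hx2 : x < wminus w b := hx.trans_le h2
      have := le_iplus (b := b) (ζ := ζ) ⟨hζ0.le, hζb.le⟩ hx5.le
      simp only [Hminus, Hplus, h1, h2, not_lt.mpr hx1.le, hx2, if_true, if_false]
      linarith
  · filter_upwards [mem_nhdsWithin_of_mem_nhds (lt_mem_nhds h1'),
        mem_nhdsWithin_of_mem_nhds (lt_mem_nhds (not_le.mp h2))] with x hx1 hx2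
    have hx1 : wplus b w 0 < x := hx1
    have hx2 : wminus w b < x := hx2
    simp only [Hminus, Hplus, h1, h2, not_lt.mpr hx1.le, not_lt.mpr hx2.le, if_false]
    linarith

/-- There exists `η` with `∑_{e=l}^m H_e⁻(η) ≤ ∑_{e=l}^m α(e) ≤ ∑_{e=l}^m H_e⁺(η)`
if and only if `0 ≤ ∑_{e=l}^m α(e) ≤ ∑_{e=l}^m β(e)`. -/
theorem exists_eta_iff (n l m : ℕ) (hl : 1 ≤ l) (hlm : l ≤ m) (hmn : m ≤ n)
    (β : ℕ → ℝ) (hβ : ∀ e, 0 < β e)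
    (w : ℕ → ℝ → ℝ) (hw : ∀ e, ConvexOn ℝ (Set.Icc 0 (β e)) (w e))
    (α : ℕ → ℝ) :
    (∃ η : ℝ,
        ∑ e ∈ Finset.Icc l m, Hminus (β e) (w e) η ≤ ∑ e ∈ Finset.Icc l m, α e ∧
        ∑ e ∈ Finset.Icc l m, α e ≤ ∑ e ∈ Finset.Icc l m, Hplus (β e) (w e) η) ↔
      (0 ≤ ∑ e ∈ Finset.Icc l m, α e ∧
        ∑ e ∈ Finset.Icc l m, α e ≤ ∑ e ∈ Finset.Icc l m, β e) := by
  classical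
  set I := Finset.Icc l m with hI
  set S := ∑ e ∈ I, α e with hS
  constructor
  · rintro ⟨η, h1, h2⟩
    exact ⟨(Finset.sum_nonneg fun e _ => Hminus_nonneg (hβ e) _ _).trans h1,
      h2.trans (Finset.sum_le_sum fun e _ => Hplus_le (hβ e) _ _)⟩
  rintro ⟨hS0, hSb⟩
  have hlow : ∃ L : ℝ, ∀ x ≤ L, ∀ e ∈ I, x < wplus (β e) (w e) 0 := by
    have : ∀ᶠ x in Filter.atBot, ∀ e ∈ I, x < wplus (β e) (w e) 0 := by
      rw [Filter.eventually_all_finset]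
      exact fun e _ => Filter.eventually_lt_atBot _
    exact Filter.eventually_atBot.mp this
  obtain ⟨L, hL⟩ := hlow
  have hHp0 : ∀ x ≤ L, ∑ e ∈ I, Hplus (β e) (w e) x = 0 := fun x hx =>
    Finset.sum_eq_zero fun e he => by simp [Hplus, hL x hx e he]
  rcases hS0.eq_or_lt with h0 | hpos
  · refine ⟨L, ?_, ?_⟩
    · rw [← h0]
      refine le_of_eq (Finset.sum_eq_zero fun e he => ?_)
      simp [Hminus, (hL L le_rfl e he).le]
    · rw [← h0, hHp0 L le_rfl]
  have hhigh : ∃ U : ℝ, ∀ e ∈ I, wplus (β e) (w e) 0 ≤ U ∧ wminus (w e) (β e) ≤ U := by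
    have : ∀ᶠ x in Filter.atTop, ∀ e ∈ I, wplus (β e) (w e) 0 ≤ x ∧ wminus (w e) (β e) ≤ x := by
      rw [Filter.eventually_all_finset]
      exact fun e _ => (Filter.eventually_ge_atTop _).and (Filter.eventually_ge_atTop _)
    exact this.exists
  obtain ⟨U, hU⟩ := hhigh
  set T : Set ℝ := {x | S ≤ ∑ e ∈ I, Hplus (β e) (w e) x} with hT
  have hTne : T.Nonempty := by
    refine ⟨U, hSb.trans (le_of_eq (Finset.sum_congr rfl fun e he => ?_))⟩
    simp [Hplus, not_lt.mpr (hU e he).1, not_lt.mpr (hU e he).2]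
  have hTbdd : BddBelow T := by
    refine ⟨L, fun x hx => ?_⟩
    by_contra! h
    have hx : S ≤ ∑ e ∈ I, Hplus (β e) (w e) x := hx
    rw [hHp0 x h.le] at hx
    linarith
  have key : ∀ A B : ℝ, (∀ ε > 0, A ≤ B + I.card * ε) → A ≤ B := by
    intro A B h
    refine le_of_forall_pos_le_add fun δ hδ => ?_
    have hc : (0 : ℝ) < I.card + 1 := by positivity
    refine (h (δ / (I.card + 1)) (by positivity)).trans ?_
    have : (I.card : ℝ) * (δ / (I.card + 1)) ≤ δ := by
      rw [mul_div_assoc', div_le_iff₀ hc]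
      nlinarith
    linarith
  have hsum : ∀ (f : ℕ → ℝ) (ε : ℝ), ∑ e ∈ I, (f e + ε) = ∑ e ∈ I, f e + I.card * ε := by
    intro f ε
    rw [Finset.sum_add_distrib, Finset.sum_const, nsmul_eq_mul]
  refine ⟨sInf T, key _ _ fun ε hε => ?_, key _ _ fun ε hε => ?_⟩
  · have hev : ∀ᶠ x in nhdsWithin (sInf T) (Set.Iio (sInf T)), ∀ e ∈ I,
        Hminus (β e) (w e) (sInf T) ≤ Hplus (β e) (w e) x + ε := by
      rw [Filter.eventually_all_finset]
      exact fun e _ => Hminus_left (hβ e) (hw e) _ hε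
    obtain ⟨x, hx, hxlt⟩ := (hev.and self_mem_nhdsWithin).exists
    have hxT : ¬ S ≤ ∑ e ∈ I, Hplus (β e) (w e) x := fun h =>
      not_le.mpr hxlt (csInf_le hTbdd h)
    have h := Finset.sum_le_sum hx
    rw [hsum] at h
    linarith
  · have hev : ∀ᶠ x in nhdsWithin (sInf T) (Set.Ici (sInf T)), ∀ e ∈ I,
        Hplus (β e) (w e) x ≤ Hplus (β e) (w e) (sInf T) + ε := by
      rw [Filter.eventually_all_finset]
      exact fun e _ => Hplus_right (hβ e) (hw e) _ hε
    obtain ⟨u, hu, hsub⟩ := mem_nhdsGE_iff_exists_Ico_subset.mp hev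
    obtain ⟨x, hxT, hxu⟩ := exists_lt_of_csInf_lt hTne hu
    have hx := hsub ⟨csInf_le hTbdd hxT, hxu⟩
    have h := Finset.sum_le_sum hx
    rw [hsum] at h
    exact le_trans hxT h
end

section
/- Let 1 ≤ v ≤ t < w ≤ m and suppose the problems Nested(v,t), Nested(t+1,w) and Nested(v,w) all have feasible points. Let x↓ be an optimal solution of Nested(v,t) and x↑ an optimal solution of Nested(t+1,w). Then there exists an optimal solution x* of Nested(v,w) such that x*(e) ≤ x↓(e) for every e with s_{v−1} < e ≤ s_t and x*(e) ≥ x↑(e) for every e with s_t < e ≤ s_w. -/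
/-- Feasibility for problem `Nested(v, w)`: integer vectors `x` indexed by
`s_{v-1} < e ≤ s_w` with `0 ≤ x(e) ≤ β(e)`, the nested sum constraints
`∑_{e=s_{v-1}+1}^{s_l} x(e) ≤ a_l − a_{v−1}` for `l = v,…,w−1`, and
`∑_{e=s_{v-1}+1}^{s_w} x(e) = a_w − a_{v−1}`. -/
def NestedFeasible (s : ℕ → ℕ) (a : ℕ → ℝ) (β : ℕ → ℕ) (v w : ℕ) (x : ℕ → ℤ) : Prop :=
  (∀ e, s (v - 1) < e → e ≤ s w → 0 ≤ x e ∧ x e ≤ (β e : ℤ)) ∧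
  (∀ l, v ≤ l → l < w →
    ((∑ e ∈ Finset.Ioc (s (v - 1)) (s l), x e : ℤ) : ℝ) ≤ a l - a (v - 1)) ∧
  ((∑ e ∈ Finset.Ioc (s (v - 1)) (s w), x e : ℤ) : ℝ) = a w - a (v - 1)

/-- Optimality for problem `Nested(v, w)` with separable convex costs `c_e`. -/
def NestedOptimal (s : ℕ → ℕ) (a : ℕ → ℝ) (β : ℕ → ℕ) (c : ℕ → ℝ → ℝ)
    (v w : ℕ) (x : ℕ → ℤ) : Prop :=
  NestedFeasible s a β v w x ∧
  ∀ y : ℕ → ℤ, NestedFeasible s a β v w y →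
    ∑ e ∈ Finset.Ioc (s (v - 1)) (s w), c e (x e) ≤
      ∑ e ∈ Finset.Ioc (s (v - 1)) (s w), c e (y e)

/-- Add one at `q`, subtract one at `p`. -/
def mv (x : ℕ → ℤ) (q p : ℕ) : ℕ → ℤ :=
  fun i => if i = q then x i + 1 else if i = p then x i - 1 else x i

theorem mv_sum {M : Type*} [AddCommGroup M] (S : Finset ℕ) (g : ℕ → ℤ → M) (x : ℕ → ℤ)
    (q p : ℕ) (h : q ≠ p) :
    ∑ i ∈ S, g i (mv x q p i) = ∑ i ∈ S, g i (x i)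
      + (if q ∈ S then g q (x q + 1) - g q (x q) else 0)
      + (if p ∈ S then g p (x p - 1) - g p (x p) else 0) := by
  have h1 : ∀ i ∈ S, g i (mv x q p i) = g i (x i)
      + (if q = i then g q (x q + 1) - g q (x q) else 0)
      + (if p = i then g p (x p - 1) - g p (x p) else 0) := by
    intro i _
    unfold mv
    by_cases h1 : i = q
    · subst h1
      simp [h.symm]
    · by_cases h2 : i = p
      · subst h2
        simp [h, h1]
      · simp [h1, h2, Ne.symm h1, Ne.symm h2]
  rw [Finset.sum_congr rfl h1, Finset.sum_add_distrib, Finset.sum_add_distrib,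
    Finset.sum_ite_eq, Finset.sum_ite_eq]

theorem mv_prefix (A n : ℕ) (x : ℕ → ℤ) (q p : ℕ) (h : q ≠ p) (hq : A < q) (hp : A < p) :
    ∑ i ∈ Finset.Ioc A n, mv x q p i = ∑ i ∈ Finset.Ioc A n, x i
      + (if q ≤ n then 1 else 0) - (if p ≤ n then 1 else 0) := by
  have := mv_sum (Finset.Ioc A n) (fun _ k => k) x q p h
  simp only [Finset.mem_Ioc, hq, hp, true_and] at this
  rw [this]
  split_ifs <;> ring

theorem convex_exch (c : ℝ → ℝ) (hc : ConvexOn ℝ Set.univ c) (a b : ℤ) (h : a < b) :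
    c ((a + 1 : ℤ) : ℝ) + c ((b - 1 : ℤ) : ℝ) ≤ c a + c b := by
  have h' : (a : ℝ) + 1 ≤ b := by exact_mod_cast h
  have hd : (0 : ℝ) < b - a := by linarith
  set r : ℝ := 1 / ((b : ℝ) - a) with hr
  have hr0 : 0 ≤ r := by positivity
  have hr1 : r ≤ 1 := by rw [hr, div_le_one hd]; linarith
  have hrm : r * ((b : ℝ) - a) = 1 := by rw [hr]; field_simp
  have e1 := hc.2 (Set.mem_univ (a : ℝ)) (Set.mem_univ (b : ℝ)) (sub_nonneg.2 hr1) hr0 (by ring)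
  have e2 := hc.2 (Set.mem_univ (a : ℝ)) (Set.mem_univ (b : ℝ)) hr0 (sub_nonneg.2 hr1) (by ring)
  simp only [smul_eq_mul] at e1 e2
  have g1 : (1 - r) * (a : ℝ) + r * b = ((a + 1 : ℤ) : ℝ) := by push_cast; linarith
  have g2 : r * (a : ℝ) + (1 - r) * b = ((b - 1 : ℤ) : ℝ) := by push_cast; linarith
  rw [g1] at e1
  rw [g2] at e2
  linarith

/-- Combinatorial search for an exchange partner. -/
theorem partner (x z : ℕ → ℤ) (D : ℕ → ℤ) (A T : ℕ)
    (hD : ∀ i, A ≤ i → D (i + 1) = D i + x (i + 1) - z (i + 1))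
    (hA : 0 ≤ D A) (hT : D T ≤ 0) (e : ℕ) (he : A < e) (heT : e ≤ T) (hxe : z e < x e) :
    ∃ f, A < f ∧ f ≤ T ∧ x f < z f ∧
      ((e < f ∧ ∀ i, e ≤ i → i < f → 0 < D i) ∨ (f < e ∧ ∀ i, f ≤ i → i < e → D i < 0)) := by
  by_cases h0 : 0 < D e
  · -- first such index after e
    have hex : ∃ f, e < f ∧ f ≤ T ∧ x f < z f := by
      by_contra! hno
      have : ∀ i, e ≤ i → i ≤ T → 0 < D i := by
        intro i hi
        induction i, hi using Nat.le_induction with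
        | base => intro _; exact h0
        | succ n hn ih =>
          intro hnT
          have := hno (n + 1) (by omega) hnT
          have := hD n (by omega)
          have := ih (by omega)
          omega
      have := this T heT le_rfl
      omega
    classical
    obtain ⟨h1, h2, h3⟩ := Nat.find_spec hex
    have hmin := fun k => @Nat.find_min _ _ hex k
    generalize Nat.find hex = f at *
    refine ⟨f, by omega, h2, h3, Or.inl ⟨h1, ?_⟩⟩
    intro i hi
    induction i, hi using Nat.le_induction with
    | base => intro _; exact h0
    | succ n hn ih =>
      intro hnT
      have := hmin (n + 1) hnT
      have := hD n (by omega)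
      have := ih (by omega)
      omega
  · have hstep := hD (e - 1) (by omega)
    rw [Nat.sub_add_cancel (by omega)] at hstep
    have h1 : D (e - 1) < 0 := by omega
    -- last such index before e
    have key : ∀ k, (∃ f, A < f ∧ f < e ∧ x f < z f ∧ ∀ i, f ≤ i → i < e → D i < 0) ∨
        (A + k < e → ∀ i, e - 1 - k ≤ i → i < e → D i < 0) := by
      intro k
      induction k with
      | zero =>
        right
        intro _ i hi hi2
        have : i = e - 1 := by omega
        rw [this]; exact h1
      | succ n ih =>
        rcases ih with ih | ih
        · exact Or.inl ih
        · by_cases hAe : A + (n + 1) < e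
          · have ih' := ih (by omega)
            by_cases hx : x (e - 1 - n) < z (e - 1 - n)
            · exact Or.inl ⟨e - 1 - n, by omega, by omega, hx, ih'⟩
            · right
              intro _ i hi hi2
              by_cases hi3 : e - 1 - n ≤ i
              · exact ih' i hi3 hi2
              · have h4 := hD i (by omega)
                have h5 : i + 1 = e - 1 - n := by omega
                rw [h5] at h4
                have := ih' (e - 1 - n) le_rfl (by omega)
                omega
          · right
            intro h; omega
    rcases key (e - 1 - A) with ⟨f, k1, k2, k3, k4⟩ | h
    · exact ⟨f, k1, by omega, k3, Or.inr ⟨k2, k4⟩⟩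
    · have := h (by omega) A (by omega) (by omega)
      omega

theorem mv_feasible (s : ℕ → ℕ) (a : ℕ → ℝ) (β : ℕ → ℕ) (v w : ℕ) (x : ℕ → ℤ)
    (hx : NestedFeasible s a β v w x) (q p : ℕ) (hqp : q ≠ p)
    (hq : s (v - 1) < q) (hq' : q ≤ s w) (hp : s (v - 1) < p) (hp' : p ≤ s w)
    (hxq : x q < β q) (hxp : 0 < x p)
    (hl : ∀ l, v ≤ l → l < w → q ≤ s l → s l < p →
      ((∑ e ∈ Finset.Ioc (s (v - 1)) (s l), x e + 1 : ℤ) : ℝ) ≤ a l - a (v - 1)) :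
    NestedFeasible s a β v w (mv x q p) := by
  obtain ⟨h1, h2, h3⟩ := hx
  refine ⟨?_, ?_, ?_⟩
  · intro e he he'
    have := h1 e he he'
    unfold mv
    split_ifs with c1 c2
    · subst c1; omega
    · subst c2; omega
    · exact this
  · intro l hvl hlw
    rw [mv_prefix _ _ _ _ _ hqp hq hp]
    have g2 := h2 l hvl hlw
    have g := hl l hvl hlw
    by_cases c1 : q ≤ s l <;> by_cases c2 : p ≤ s l
    · simpa [c1, c2] using g2
    · simpa [c1, c2] using g c1 (by omega)
    · simp only [c1, c2, if_true, if_false]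
      push_cast at g2 ⊢
      linarith
    · simpa [c1, c2] using g2
  · rw [mv_prefix _ _ _ _ _ hqp hq hp]
    simpa [hq', hp'] using h3

theorem exists_optimal (s : ℕ → ℕ) (a : ℕ → ℝ) (β : ℕ → ℕ) (c : ℕ → ℝ → ℝ) (v w : ℕ)
    (hsm : ∀ l, v ≤ l → l < w → s l ≤ s w)
    (h : ∃ x, NestedFeasible s a β v w x) : ∃ x, NestedOptimal s a β c v w x := by
  set W := s w with hW
  let ext : (Fin (W + 1) → ℤ) → ℕ → ℤ := fun g i => if hi : i < W + 1 then g ⟨i, hi⟩ else 0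
  let res : (ℕ → ℤ) → Fin (W + 1) → ℤ := fun x i => if s (v - 1) < (i : ℕ) then x i else 0
  have hag : ∀ x i, s (v - 1) < i → i ≤ W → ext (res x) i = x i := by
    intro x i h1 h2
    simp only [ext, res, h1, Nat.lt_succ_of_le h2, dif_pos, if_true]
  have hsum : ∀ x n, n ≤ W → ∑ e ∈ Finset.Ioc (s (v - 1)) n, ext (res x) e
      = ∑ e ∈ Finset.Ioc (s (v - 1)) n, x e := by
    intro x n hn
    apply Finset.sum_congr rfl
    intro i hi
    rw [Finset.mem_Ioc] at hi
    exact hag x i hi.1 (by omega)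
  have hfe : ∀ x, NestedFeasible s a β v w x → NestedFeasible s a β v w (ext (res x)) := by
    rintro x ⟨h1, h2, h3⟩
    refine ⟨?_, ?_, ?_⟩
    · intro e he he'
      rw [hag x e he he']; exact h1 e he he'
    · intro l hl hl'
      rw [hsum x _ (hsm l hl hl')]; exact h2 l hl hl'
    · rw [hsum x _ le_rfl]; exact h3
  let B : Set (Fin (W + 1) → ℤ) :=
    {g | g ∈ Set.Icc (0 : Fin (W + 1) → ℤ) (fun i => (β i : ℤ)) ∧ NestedFeasible s a β v w (ext g)}
  have hB : B.Finite := (Set.finite_Icc _ _).subset (fun g hg => hg.1)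
  have hmem : ∀ x, NestedFeasible s a β v w x → res x ∈ B := by
    intro x hx
    refine ⟨⟨?_, ?_⟩, hfe x hx⟩
    · intro i
      simp only [res, Pi.zero_apply]
      split_ifs with hi
      · exact (hx.1 i hi (by omega)).1
      · exact le_rfl
    · intro i
      simp only [res]
      split_ifs with hi
      · exact (hx.1 i hi (by omega)).2
      · positivity
  obtain ⟨x0, hx0⟩ := h
  obtain ⟨g, hg, hmin⟩ := Set.exists_min_image B
    (fun g => ∑ e ∈ Finset.Ioc (s (v - 1)) (s w), c e (ext g e)) hB ⟨_, hmem x0 hx0⟩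
  refine ⟨ext g, hg.2, fun y hy => ?_⟩
  refine (hmin _ (hmem y hy)).trans (le_of_eq ?_)
  apply Finset.sum_congr rfl
  intro i hi
  rw [Finset.mem_Ioc] at hi
  rw [hag y i hi.1 hi.2]

/-- One exchange step. -/
theorem improve (s : ℕ → ℕ) (a : ℕ → ℝ) (β : ℕ → ℕ) (c : ℕ → ℝ → ℝ)
    (hc : ∀ e, ConvexOn ℝ Set.univ (c e)) (v t w : ℕ) (x z : ℕ → ℤ)
    (hx : NestedOptimal s a β c v w x) (hz : NestedFeasible s a β v w z)
    (hzt : ((∑ e ∈ Finset.Ioc (s (v - 1)) (s t), z e : ℤ) : ℝ) = a t - a (v - 1))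
    (hzo : ∀ y, NestedFeasible s a β v w y →
      ((∑ e ∈ Finset.Ioc (s (v - 1)) (s t), y e : ℤ) : ℝ) = a t - a (v - 1) →
      ∑ e ∈ Finset.Ioc (s (v - 1)) (s w), c e (z e) ≤
        ∑ e ∈ Finset.Ioc (s (v - 1)) (s w), c e (y e))
    (p q : ℕ) (hq : s (v - 1) < q) (hq' : q ≤ s w) (hp : s (v - 1) < p) (hp' : p ≤ s w)
    (hxp : z p < x p) (hxq : x q < z q) (hside : p ≤ s t ↔ q ≤ s t)
    (h1 : ∀ i, q ≤ i → i < p →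
      ∑ e ∈ Finset.Ioc (s (v - 1)) i, x e < ∑ e ∈ Finset.Ioc (s (v - 1)) i, z e)
    (h2 : ∀ i, p ≤ i → i < q →
      ∑ e ∈ Finset.Ioc (s (v - 1)) i, z e < ∑ e ∈ Finset.Ioc (s (v - 1)) i, x e) :
    ∃ x', NestedOptimal s a β c v w x' ∧
      ∑ e ∈ Finset.Ioc (s (v - 1)) (s w), |x' e - z e| <
      ∑ e ∈ Finset.Ioc (s (v - 1)) (s w), |x e - z e| := by
  have hqp : q ≠ p := by rintro rfl; omega
  obtain ⟨hxf, hxo⟩ := hx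
  have bzp := hz.1 p hp hp'
  have bzq := hz.1 q hq hq'
  have bxp := hxf.1 p hp hp'
  have bxq := hxf.1 q hq hq'
  have F1 : NestedFeasible s a β v w (mv x q p) := by
    apply mv_feasible s a β v w x hxf q p hqp hq hq' hp hp' (by omega) (by omega)
    intro l hl hl' hql hlp
    refine le_trans ?_ (hz.2.1 l hl hl')
    exact_mod_cast h1 _ hql hlp
  have F2 : NestedFeasible s a β v w (mv z p q) := by
    apply mv_feasible s a β v w z hz p q hqp.symm hp hp' hq hq' (by omega) (by omega)
    intro l hl hl' hql hlp
    refine le_trans ?_ (hxf.2.1 l hl hl')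
    exact_mod_cast h2 _ hql hlp
  have F3 : ((∑ e ∈ Finset.Ioc (s (v - 1)) (s t), mv z p q e : ℤ) : ℝ) = a t - a (v - 1) := by
    rw [mv_prefix _ _ _ _ _ hqp.symm hp hq, ← hzt]
    by_cases h : p ≤ s t
    · simp [h, hside.1 h]
    · have : ¬ q ≤ s t := fun h' => h (hside.2 h')
      simp [h, this]
  have C2 := hzo _ F2 F3
  rw [mv_sum _ (fun e k => c e (k : ℝ)) z p q hqp.symm] at C2
  have C1 := mv_sum (Finset.Ioc (s (v - 1)) (s w)) (fun e k => c e (k : ℝ)) x q p hqp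
  have K1 := mv_sum (Finset.Ioc (s (v - 1)) (s w)) (fun e k => |k - z e|) x q p hqp
  simp only [Finset.mem_Ioc, hp, hp', hq, hq', and_self, if_true] at C1 C2 K1
  have E1 := convex_exch (c p) (hc p) _ _ hxp
  have E2 := convex_exch (c q) (hc q) _ _ hxq
  refine ⟨mv x q p, ⟨F1, fun y hy => le_trans ?_ (hxo y hy)⟩, ?_⟩
  · rw [C1]; linarith
  · rw [K1]
    have a1 : |x q + 1 - z q| = z q - x q - 1 := by rw [abs_of_nonpos (by omega)]; ring
    have a2 : |x q - z q| = z q - x q := by rw [abs_of_nonpos (by omega)]; ring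
    have a3 : |x p - 1 - z p| = x p - 1 - z p := abs_of_nonneg (by omega)
    have a4 : |x p - z p| = x p - z p := abs_of_nonneg (by omega)
    rw [a1, a2, a3, a4]; omega

theorem descend (s : ℕ → ℕ) (a : ℕ → ℝ) (β : ℕ → ℕ) (c : ℕ → ℝ → ℝ)
    (hc : ∀ e, ConvexOn ℝ Set.univ (c e)) (v t w : ℕ)
    (hvt : v ≤ t) (htw : t < w) (hsvt : s (v - 1) ≤ s t) (hstw : s t ≤ s w) (z : ℕ → ℤ)
    (hz : NestedFeasible s a β v w z)
    (hzt : ((∑ e ∈ Finset.Ioc (s (v - 1)) (s t), z e : ℤ) : ℝ) = a t - a (v - 1))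
    (hzo : ∀ y, NestedFeasible s a β v w y →
      ((∑ e ∈ Finset.Ioc (s (v - 1)) (s t), y e : ℤ) : ℝ) = a t - a (v - 1) →
      ∑ e ∈ Finset.Ioc (s (v - 1)) (s w), c e (z e) ≤
        ∑ e ∈ Finset.Ioc (s (v - 1)) (s w), c e (y e))
    (n : ℕ) : ∀ x, NestedOptimal s a β c v w x →
      (∑ e ∈ Finset.Ioc (s (v - 1)) (s w), |x e - z e|) = (n : ℤ) →
    ∃ y, NestedOptimal s a β c v w y ∧
      (∀ e, s (v - 1) < e → e ≤ s t → y e ≤ z e) ∧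
      (∀ e, s t < e → e ≤ s w → z e ≤ y e) := by
  induction n using Nat.strong_induction_on with
  | _ n ih =>
  intro x hx hn
  have step : (∃ x', NestedOptimal s a β c v w x' ∧
      ∑ e ∈ Finset.Ioc (s (v - 1)) (s w), |x' e - z e| <
      ∑ e ∈ Finset.Ioc (s (v - 1)) (s w), |x e - z e|) → ∃ y, NestedOptimal s a β c v w y ∧
      (∀ e, s (v - 1) < e → e ≤ s t → y e ≤ z e) ∧
      (∀ e, s t < e → e ≤ s w → z e ≤ y e) := by
    rintro ⟨x', hx', hlt⟩
    have h0 : 0 ≤ ∑ e ∈ Finset.Ioc (s (v - 1)) (s w), |x' e - z e| :=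
      Finset.sum_nonneg (fun _ _ => abs_nonneg _)
    refine ih (∑ e ∈ Finset.Ioc (s (v - 1)) (s w), |x' e - z e|).toNat (by omega) x' hx' (by omega)
  have hDT : ∑ e ∈ Finset.Ioc (s (v - 1)) (s t), x e ≤ ∑ e ∈ Finset.Ioc (s (v - 1)) (s t), z e := by
    have := (hx.1.2.1 t hvt htw).trans hzt.ge
    exact_mod_cast this
  have hDW : ∑ e ∈ Finset.Ioc (s (v - 1)) (s w), x e = ∑ e ∈ Finset.Ioc (s (v - 1)) (s w), z e := by
    have := hx.1.2.2.trans hz.2.2.symm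
    exact_mod_cast this
  have hsucc : ∀ (u : ℕ → ℤ) i, s (v - 1) ≤ i → ∑ e ∈ Finset.Ioc (s (v - 1)) (i + 1), u e
      = ∑ e ∈ Finset.Ioc (s (v - 1)) i, u e + u (i + 1) := fun u i hi =>
    Finset.sum_Ioc_succ_top hi u
  by_cases hlow : ∃ e, s (v - 1) < e ∧ e ≤ s t ∧ z e < x e
  · obtain ⟨e, he, het, hze⟩ := hlow
    obtain ⟨f, f1, f2, f3, f4⟩ := partner x z
      (fun i => ∑ e ∈ Finset.Ioc (s (v - 1)) i, x e - ∑ e ∈ Finset.Ioc (s (v - 1)) i, z e)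
      (s (v - 1)) (s t) (fun i hi => by simp only [hsucc _ i hi]; ring) (by simp)
      (by simpa using hDT) e he het hze
    apply step
    apply improve s a β c hc v t w x z hx hz hzt hzo e f f1 (by omega) he (by omega) hze f3
      (by omega)
    · intro i hi hi'
      rcases f4 with ⟨g, _⟩ | ⟨_, g⟩
      · omega
      · have := g i hi hi'; omega
    · intro i hi hi'
      rcases f4 with ⟨_, g⟩ | ⟨g, _⟩
      · have := g i hi hi'; omega
      · omega
  by_cases hhigh : ∃ e, s t < e ∧ e ≤ s w ∧ x e < z e
  · obtain ⟨e, he, het, hze⟩ := hhigh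
    obtain ⟨f, f1, f2, f3, f4⟩ := partner z x
      (fun i => ∑ e ∈ Finset.Ioc (s (v - 1)) i, z e - ∑ e ∈ Finset.Ioc (s (v - 1)) i, x e)
      (s t) (s w) (fun i hi => by simp only [hsucc _ i (by omega)]; ring) (by simpa using hDT)
      (by simp [hDW]) e he het hze
    apply step
    apply improve s a β c hc v t w x z hx hz hzt hzo f e (by omega) het (by omega) f2 f3 hze
      (by omega)
    · intro i hi hi'
      rcases f4 with ⟨_, g⟩ | ⟨g, _⟩
      · have := g i hi hi'; omega
      · omega
    · intro i hi hi'
      rcases f4 with ⟨g, _⟩ | ⟨_, g⟩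
      · omega
      · have := g i hi hi'; omega
  push Not at hlow hhigh
  exact ⟨x, hx, hlow, hhigh⟩

/-- Vidal et al.'s decomposition principle: if `x↓` is optimal for `Nested(v,t)` and
`x↑` is optimal for `Nested(t+1,w)`, then `Nested(v,w)` has an optimal solution `x*`
with `x*(e) ≤ x↓(e)` on the lower block and `x*(e) ≥ x↑(e)` on the upper block. -/
theorem nested_decomposition (m : ℕ) (s : ℕ → ℕ) (hs0 : s 0 = 0)
    (hsmono : ∀ i < m, s i < s (i + 1))
    (a : ℕ → ℝ) (ha0 : a 0 = 0) (β : ℕ → ℕ)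
    (c : ℕ → ℝ → ℝ) (hc : ∀ e, ConvexOn ℝ Set.univ (c e))
    (v t w : ℕ) (hv : 1 ≤ v) (hvt : v ≤ t) (htw : t < w) (hwm : w ≤ m)
    (hfeas1 : ∃ x, NestedFeasible s a β v t x)
    (hfeas2 : ∃ x, NestedFeasible s a β (t + 1) w x)
    (hfeas3 : ∃ x, NestedFeasible s a β v w x)
    (xdown : ℕ → ℤ) (hdown : NestedOptimal s a β c v t xdown)
    (xup : ℕ → ℤ) (hup : NestedOptimal s a β c (t + 1) w xup) :
    ∃ xstar : ℕ → ℤ, NestedOptimal s a β c v w xstar ∧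
      (∀ e, s (v - 1) < e → e ≤ s t → xstar e ≤ xdown e) ∧
      (∀ e, s t < e → e ≤ s w → xup e ≤ xstar e) := by
  have hsm : ∀ i j, i ≤ j → j ≤ m → s i ≤ s j := by
    intro i j hij
    induction j, hij using Nat.le_induction with
    | base => intro _; exact le_rfl
    | succ n hn ih =>
      intro h
      exact (ih (by omega)).trans (hsmono n (by omega)).le
  have hvt' : s (v - 1) ≤ s t := hsm _ _ (by omega) (by omega)
  have htw' : s t ≤ s w := hsm _ _ htw.le hwm
  have split : ∀ {M : Type} [AddCommMonoid M] (g : ℕ → M) n, s t ≤ n →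
      ∑ e ∈ Finset.Ioc (s (v - 1)) n, g e
        = ∑ e ∈ Finset.Ioc (s (v - 1)) (s t), g e + ∑ e ∈ Finset.Ioc (s t) n, g e := by
    intro M _ g n hn
    exact (Finset.sum_Ioc_consecutive g hvt' hn).symm
  obtain ⟨⟨d1, d2, d3⟩, dopt⟩ := hdown
  obtain ⟨⟨u1, u2, u3⟩, uopt⟩ := hup
  simp only [Nat.add_sub_cancel] at u1 u2 u3 uopt
  set z : ℕ → ℤ := fun e => if e ≤ s t then xdown e else xup e with hzdef
  have zlo : ∀ e, e ≤ s t → z e = xdown e := fun e he => by simp [hzdef, he]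
  have zhi : ∀ e, s t < e → z e = xup e := fun e he => by simp [hzdef, he]
  have zslo : ∀ n, n ≤ s t → ∑ e ∈ Finset.Ioc (s (v - 1)) n, z e
      = ∑ e ∈ Finset.Ioc (s (v - 1)) n, xdown e := fun n hn =>
    Finset.sum_congr rfl (fun i hi => zlo i (by rw [Finset.mem_Ioc] at hi; omega))
  have zshi : ∀ n, ∑ e ∈ Finset.Ioc (s t) n, z e = ∑ e ∈ Finset.Ioc (s t) n, xup e := fun n =>
    Finset.sum_congr rfl (fun i hi => zhi i (by rw [Finset.mem_Ioc] at hi; omega))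
  have hzt : ((∑ e ∈ Finset.Ioc (s (v - 1)) (s t), z e : ℤ) : ℝ) = a t - a (v - 1) := by
    rw [zslo _ le_rfl]; exact d3
  have hz : NestedFeasible s a β v w z := by
    refine ⟨?_, ?_, ?_⟩
    · intro e he he'
      by_cases h : e ≤ s t
      · rw [zlo e h]; exact d1 e he h
      · rw [zhi e (by omega)]; exact u1 e (by omega) he'
    · intro l hl hl'
      rcases lt_trichotomy l t with h | h | h
      · rw [zslo _ (hsm _ _ h.le (by omega))]; exact d2 l hl h
      · subst h; exact hzt.le
      · rw [split z _ (hsm _ _ h.le (by omega)), zshi, Int.cast_add, hzt]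
        have := u2 l h hl'
        linarith
    · rw [split z _ htw', zshi, Int.cast_add, hzt, u3]
      ring
  have hzo : ∀ y, NestedFeasible s a β v w y →
      ((∑ e ∈ Finset.Ioc (s (v - 1)) (s t), y e : ℤ) : ℝ) = a t - a (v - 1) →
      ∑ e ∈ Finset.Ioc (s (v - 1)) (s w), c e (z e) ≤
        ∑ e ∈ Finset.Ioc (s (v - 1)) (s w), c e (y e) := by
    rintro y ⟨y1, y2, y3⟩ hyt
    rw [split (fun e => c e (z e)) _ htw', split (fun e => c e (y e)) _ htw']
    apply add_le_add
    · refine le_trans (le_of_eq ?_) (dopt y ⟨?_, ?_, hyt⟩)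
      · refine Finset.sum_congr rfl (fun i hi => ?_)
        rw [Finset.mem_Ioc] at hi
        rw [zlo i hi.2]
      · intro e he he'
        exact y1 e he (by omega)
      · intro l hl hl'
        exact y2 l hl (by omega)
    · refine le_trans (le_of_eq ?_) (uopt y ⟨?_, ?_, ?_⟩)
      · refine Finset.sum_congr rfl (fun i hi => ?_)
        rw [Finset.mem_Ioc] at hi
        rw [zhi i hi.1]
      · intro e he he'
        simp only [Nat.add_sub_cancel] at he
        exact y1 e (by omega) he'
      · intro l hl hl'
        have := y2 l (by omega) hl'
        rw [split y _ (hsm _ _ (by omega) (by omega)), Int.cast_add, hyt] at this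
        simp only [Nat.add_sub_cancel]
        linarith
      · rw [split y _ htw', Int.cast_add, hyt] at y3
        simp only [Nat.add_sub_cancel]
        linarith
  obtain ⟨x, hx⟩ := exists_optimal s a β c v w
    (fun l _ hl => hsm l w hl.le hwm) hfeas3
  obtain ⟨y, hy, hlo, hhi⟩ := descend s a β c hc v t w hvt htw hvt' htw' z hz hzt hzo
    (∑ e ∈ Finset.Ioc (s (v - 1)) (s w), |x e - z e|).toNat x hx
    (Int.toNat_of_nonneg (Finset.sum_nonneg (fun _ _ => abs_nonneg _))).symm
  refine ⟨y, hy, ?_, ?_⟩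
  · intro e he he'
    rw [← zlo e he']; exact hlo e he he'
  · intro e he he'
    rw [← zhi e he]; exact hhi e he he'
end

section
/- Let 1 ≤ v ≤ t < w ≤ m, let x↓ be feasible for Nested(v,t) and x↑ feasible for Nested(t+1,w). If an integer vector x = (x(e))_{s_{v−1} < e ≤ s_w} satisfies 0 ≤ x(e) ≤ x↓(e) for s_{v−1} < e ≤ s_t, x↑(e) ≤ x(e) ≤ β(e) for s_t < e ≤ s_w, and Σ_{e=s_{v−1}+1}^{s_w} x(e) = a_w − a_{v−1}, then x is feasible for Nested(v,w). -/
/-- If `x↓` is feasible for `Nested(v,t)`, `x↑` is feasible for `Nested(t+1,w)`, and an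
integer vector `x` satisfies `0 ≤ x ≤ x↓` on the lower block, `x↑ ≤ x ≤ β` on the upper
block, and the total sum equality, then `x` is feasible for `Nested(v,w)`. -/
theorem sandwiched_is_nestedFeasible (m : ℕ) (s : ℕ → ℕ) (hs0 : s 0 = 0)
    (hsmono : ∀ i < m, s i < s (i + 1))
    (a : ℕ → ℝ) (ha0 : a 0 = 0) (β : ℕ → ℕ)
    (v t w : ℕ) (hv : 1 ≤ v) (hvt : v ≤ t) (htw : t < w) (hwm : w ≤ m)
    (xdown : ℕ → ℤ) (hdown : NestedFeasible s a β v t xdown)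
    (xup : ℕ → ℤ) (hup : NestedFeasible s a β (t + 1) w xup)
    (x : ℕ → ℤ)
    (hlow : ∀ e, s (v - 1) < e → e ≤ s t → 0 ≤ x e ∧ x e ≤ xdown e)
    (hhigh : ∀ e, s t < e → e ≤ s w → xup e ≤ x e ∧ x e ≤ (β e : ℤ))
    (hsum : ((∑ e ∈ Finset.Ioc (s (v - 1)) (s w), x e : ℤ) : ℝ) = a w - a (v - 1)) :
    NestedFeasible s a β v w x := by
  have mono : ∀ j, j ≤ m → ∀ i, i ≤ j → s i ≤ s j := by
    intro j
    induction j with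
    | zero =>
      intro _ i hi
      obtain rfl : i = 0 := by omega
      exact le_rfl
    | succ k ih =>
      intro hk i hi
      rcases Nat.lt_or_ge k i with h | h
      · obtain rfl : i = k + 1 := by omega
        exact le_rfl
      · exact (ih (by omega) i h).trans (hsmono k (by omega)).le
  obtain ⟨hd1, hd2, hd3⟩ := hdown
  obtain ⟨hu1, hu2, hu3⟩ := hup
  simp only [Nat.add_sub_cancel] at hu1 hu2 hu3
  refine ⟨?_, ?_, hsum⟩
  · intro e he1 he2
    rcases Nat.lt_or_ge (s t) e with h | h
    · exact ⟨(hu1 e h he2).1.trans (hhigh e h he2).1, (hhigh e h he2).2⟩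
    · exact ⟨(hlow e he1 h).1, (hlow e he1 h).2.trans (hd1 e he1 h).2⟩
  · intro l hvl hlw
    rcases Nat.lt_or_ge t l with h | h
    · have m1 : s (v - 1) ≤ s l := mono l (by omega) _ (by omega)
      have m2 : s l ≤ s w := mono w hwm _ hlw.le
      have m3 : s t ≤ s l := mono l (by omega) _ h.le
      have e1 := Finset.sum_Ioc_consecutive x m1 m2
      have e2 := Finset.sum_Ioc_consecutive xup m3 m2
      have hle : ∑ e ∈ Finset.Ioc (s l) (s w), xup e ≤ ∑ e ∈ Finset.Ioc (s l) (s w), x e := by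
        apply Finset.sum_le_sum
        intro e he
        rw [Finset.mem_Ioc] at he
        exact (hhigh e (by omega) he.2).1
      have h2 := hu2 l (by omega) hlw
      rw [← e1] at hsum
      rw [← e2] at hu3
      have hle' : ((∑ e ∈ Finset.Ioc (s l) (s w), xup e : ℤ) : ℝ) ≤
          ((∑ e ∈ Finset.Ioc (s l) (s w), x e : ℤ) : ℝ) := Int.cast_le.mpr hle
      rw [Int.cast_add] at hsum hu3
      linarith
    · have m1 : s l ≤ s t := mono t (by omega) _ h
      have hle : ∑ e ∈ Finset.Ioc (s (v - 1)) (s l), x e ≤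
          ∑ e ∈ Finset.Ioc (s (v - 1)) (s l), xdown e := by
        apply Finset.sum_le_sum
        intro e he
        rw [Finset.mem_Ioc] at he
        exact (hlow e he.1 (by omega)).2
      have hle' := (Int.cast_le (R := ℝ)).mpr hle
      refine hle'.trans ?_
      rcases Nat.lt_or_ge l t with h' | h'
      · exact hd2 l hvl h'
      · obtain rfl : l = t := by omega
        exact hd3.le
end
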